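/- arXiv:2009.12059 — 7 statements merged into one kernel-verified Lean document; each statement's English description precedes it below -/
import Mathlib

section
/- For all signed graphs (G,σ) and (H,π) and every map f : V(G) → V(H), f is a homomorphism of (G,σ) to (H,π) if and only if there exists a signature σ' with (G,σ') ∼ (G,σ) such that f is a sign-preserving homomorphism of (G,σ') to (H,π). -/
open SimpleGraph

/-- A signed graph: a simple graph together with a symmetric sign function on
ordered pairs of vertices (`true` = positive, `false` = negative); only the values
on adjacent pairs are relevant. -/
structure SignedGraph (V : Type) where
  G : SimpleGraph V
  sign : V → V → Bool
  sign_symm : ∀ u v : V, sign u v = sign v u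

namespace SignedGraph

variable {V W : Type}

/-- The sign of a walk: `true` iff it traverses an even number of negative edges
(counted with multiplicity). -/
def walkSign (S : SignedGraph V) {u v : V} (w : S.G.Walk u v) : Bool :=
  (w.darts.map fun d => S.sign d.toProd.1 d.toProd.2).foldr (· == ·) true

/-- `SwitchEquiv S T` : `T` is obtained from `S` by switching a set of vertices
(encoded by `s : V → Bool`). -/
def SwitchEquiv (S T : SignedGraph V) : Prop :=
  S.G = T.G ∧ ∃ s : V → Bool, ∀ u v : V, S.G.Adj u v →
    T.sign u v = ((s u == s v) == S.sign u v)

/-- A sign-preserving homomorphism. -/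
def IsSpHom (S : SignedGraph V) (T : SignedGraph W) (f : V → W) : Prop :=
  ∀ u v : V, S.G.Adj u v →
    T.G.Adj (f u) (f v) ∧ T.sign (f u) (f v) = S.sign u v

/-- A homomorphism of signed graphs: maps edges to edges and preserves the signs of
closed walks. -/
def IsHom (S : SignedGraph V) (T : SignedGraph W) (f : V → W) : Prop :=
  ∃ hadj : ∀ u v : V, S.G.Adj u v → T.G.Adj (f u) (f v),
    ∀ (u : V) (w : S.G.Walk u u),
      T.walkSign (w.map ⟨f, fun {a b} h => hadj a b h⟩) = S.walkSign w

/-- A sign-preserving isomorphism. -/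
def IsSpIso (S : SignedGraph V) (T : SignedGraph W) (f : V → W) : Prop :=
  Function.Bijective f ∧ IsSpHom S T f ∧
    ∃ g : W → V, Function.LeftInverse g f ∧ Function.RightInverse g f ∧ IsSpHom T S g

/-- An isomorphism of signed graphs. -/
def IsIso (S : SignedGraph V) (T : SignedGraph W) (f : V → W) : Prop :=
  Function.Bijective f ∧ IsHom S T f ∧
    ∃ g : W → V, Function.LeftInverse g f ∧ Function.RightInverse g f ∧ IsHom T S g

/-- The sign-preserving chromatic number. -/
noncomputable def chromSp (S : SignedGraph V) : ℕ :=
  sInf {n : ℕ | ∃ T : SignedGraph (Fin n), ∃ f : V → Fin n, IsSpHom S T f}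

/-- The signed chromatic number. -/
noncomputable def chromS (S : SignedGraph V) : ℕ :=
  sInf {n : ℕ | ∃ T : SignedGraph (Fin n), ∃ f : V → Fin n, IsHom S T f}

/-- The double switching graph of a signed graph. -/
def doubleSwitch (S : SignedGraph V) : SignedGraph (V × Bool) where
  G := { Adj := fun p q => S.G.Adj p.1 q.1
         symm := ⟨fun p q h => S.G.symm.symm p.1 q.1 h⟩
         loopless := ⟨fun p h => S.G.loopless.irrefl p.1 h⟩ }
  sign := fun p q => ((p.2 == q.2) == S.sign p.1 q.1)
  sign_symm := by
    rintro ⟨p1, p2⟩ ⟨q1, q2⟩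
    have := S.sign_symm p1 q1
    cases p2 <;> cases q2 <;> simp [this]

end SignedGraph

/-- `G` has a complete minor on `n` branch sets: there are `n` nonempty, pairwise
disjoint vertex sets, each inducing a connected subgraph, with an edge of `G`
between any two of them. -/
def SimpleGraph.HasCompleteMinor {V : Type} (G : SimpleGraph V) (n : ℕ) : Prop :=
  ∃ B : Fin n → Set V,
    (∀ i, (B i).Nonempty) ∧
    (∀ i, (G.induce (B i)).Connected) ∧
    (∀ i j, i ≠ j → Disjoint (B i) (B j)) ∧
    (∀ i j, i ≠ j → ∃ u ∈ B i, ∃ v ∈ B j, G.Adj u v)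



namespace SignedGraph

theorem walkSign_cons' {V : Type} (S : SignedGraph V) {u v w : V} (h : S.G.Adj u v)
    (p : S.G.Walk v w) : S.walkSign (Walk.cons h p) = (S.sign u v == S.walkSign p) := by
  simp [walkSign]

theorem walkSign_nil' {V : Type} (S : SignedGraph V) {u : V} :
    S.walkSign (Walk.nil : S.G.Walk u u) = true := by
  simp [walkSign]

theorem walkSign_append' {V : Type} (S : SignedGraph V) {u v w : V} (p : S.G.Walk u v)
    (q : S.G.Walk v w) : S.walkSign (p.append q) = (S.walkSign p == S.walkSign q) := by
  induction p with
  | nil => simp [walkSign_nil']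
  | cons h p ih =>
    rw [Walk.cons_append, walkSign_cons', walkSign_cons', ih]
    generalize S.sign _ _ = a
    generalize S.walkSign p = b
    generalize S.walkSign q = c
    revert a b c; decide

theorem walkSign_reverse' {V : Type} (S : SignedGraph V) {u v : V} (p : S.G.Walk u v) :
    S.walkSign p.reverse = S.walkSign p := by
  induction p with
  | nil => rfl
  | @cons a b c h p ih =>
    rw [Walk.reverse_cons, walkSign_append', ih, walkSign_cons', walkSign_cons', walkSign_nil',
      S.sign_symm b a]
    generalize S.sign _ _ = a
    generalize S.walkSign p = b
    revert a b; decide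

/-- A switching of the source changes the sign of a walk only through its endpoints. -/
theorem walkSign_map_of_switch {V W : Type} (S : SignedGraph V) (T : SignedGraph W)
    (φ : S.G →g T.G) (s : V → Bool)
    (hs : ∀ u v, S.G.Adj u v → S.sign u v = ((s u == s v) == T.sign (φ u) (φ v)))
    {u v : V} (w : S.G.Walk u v) :
    S.walkSign w = ((s u == s v) == T.walkSign (w.map φ)) := by
  induction w with
  | nil => simp [walkSign_nil']
  | @cons a b c h p ih =>
    rw [Walk.map_cons, walkSign_cons', walkSign_cons', ih, hs _ _ h]
    generalize T.sign _ _ = x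
    generalize T.walkSign _ = y
    generalize s a = a
    generalize s b = b
    generalize s c = c
    revert x y a b c; decide

end SignedGraph

open SignedGraph in
/-- `f` is a homomorphism of `(G,σ)` to `(H,π)` iff there is a signature `σ'` with
`(G,σ') ∼ (G,σ)` such that `f` is a sign-preserving homomorphism of `(G,σ')` to `(H,π)`. -/
theorem isHom_iff_exists_switchEquiv_isSpHom {V W : Type} [Fintype V] [Fintype W]
    (S : SignedGraph V) (T : SignedGraph W) (f : V → W) :
    IsHom S T f ↔ ∃ S' : SignedGraph V, SwitchEquiv S' S ∧ IsSpHom S' T f := by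
  constructor
  · rintro ⟨hadj, hw⟩
    let φ : S.G →g T.G := ⟨f, fun {a b} h => hadj a b h⟩
    have hw' : ∀ (u : V) (w : S.G.Walk u u), T.walkSign (w.map φ) = S.walkSign w := hw
    have hr : ∀ u, S.G.Reachable (S.G.connectedComponentMk u).out u := fun u =>
      ConnectedComponent.exact (Quot.out_eq (S.G.connectedComponentMk u))
    -- a switching function, well defined along edges
    have key : ∃ s : V → Bool, ∀ u v, S.G.Adj u v →
        T.sign (f u) (f v) = ((s u == s v) == S.sign u v) := by
      have hp : ∀ c : S.G.ConnectedComponent, ∀ u, S.G.connectedComponentMk u = c →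
          ∃ b : Bool, ∃ p : S.G.Walk c.out u, b = (T.walkSign (p.map φ) == S.walkSign p) := by
        rintro c u rfl
        obtain ⟨p⟩ := hr u
        exact ⟨_, p, rfl⟩
      choose s hs using fun u => hp _ u rfl
      refine ⟨s, fun u v h => ?_⟩
      obtain ⟨p, hp1⟩ := hs u
      obtain ⟨q, hq1⟩ := hs v
      have hc : S.G.connectedComponentMk u = S.G.connectedComponentMk v :=
        ConnectedComponent.sound h.reachable
      generalize S.G.connectedComponentMk u = c at *
      subst hc
      have h1 := hw' _ (p.append (Walk.cons h q.reverse))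
      rw [Walk.map_append, Walk.map_cons, ← Walk.reverse_map] at h1
      simp only [walkSign_append', walkSign_cons', walkSign_reverse'] at h1
      rw [hp1, hq1]
      change (_ == (T.sign (f u) (f v) == _)) = _ at h1
      revert h1
      generalize T.sign _ _ = x
      generalize S.sign _ _ = y
      generalize T.walkSign _ = a
      generalize T.walkSign _ = b
      generalize S.walkSign _ = c
      generalize S.walkSign _ = d
      revert x y a b c d; decide
    obtain ⟨s, hs⟩ := key
    refine ⟨⟨S.G, fun u v => ((s u == s v) == S.sign u v), fun u v => ?_⟩, ⟨rfl, s, ?_⟩, ?_⟩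
    · rw [S.sign_symm u v, Bool.beq_comm (a := s u)]
    · intro u v _
      dsimp only
      generalize S.sign _ _ = y
      generalize s u = a
      generalize s v = b
      revert y a b; decide
    · exact fun u v h => ⟨hadj u v h, hs u v h⟩
  · rintro ⟨S', ⟨hG, s, hs⟩, hf⟩
    rw [hG] at hs
    have hf' : ∀ u v : V, S.G.Adj u v →
        T.G.Adj (f u) (f v) ∧ T.sign (f u) (f v) = S'.sign u v := by
      rw [← hG]; exact hf
    refine ⟨fun u v h => (hf' u v h).1, fun u w => ?_⟩
    rw [walkSign_map_of_switch S T ⟨f, fun {a b} h => (hf' a b h).1⟩ s ?_ w]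
    · simp
    · intro u v h
      rw [hs u v h, ← (hf' u v h).2]
      rfl
end

section
/- For every n ≥ 3, every finite simple graph G with no K_n minor and every signature σ of G satisfy χ_s((G,σ)) ≤ 5·C(n−1,2)·2^{5·C(n−1,2)−2} and χ_sp((G,σ)) ≤ 5·C(n−1,2)·2^{5·C(n−1,2)−1}, where C(n−1,2) = (n−1)(n−2)/2 is the binomial coefficient. -/
open SimpleGraph

namespace SignedGraph

lemma exists_rec {V α : Type} (r : V → ℕ) (P : (v : V) → ((u : V) → r u < r v → α) → α → Prop)
    (h : ∀ v g, ∃ a, P v g a) : ∃ f : V → α, ∀ v, P v (fun u _ => f u) (f v) := by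
  classical
  choose F hF using h
  have wf : WellFounded (fun u v : V => r u < r v) := (measure r).wf
  refine ⟨wf.fix F, fun v => ?_⟩
  rw [wf.fix_eq]
  exact hF v _

lemma chromSp_le_card {V W : Type} [Fintype W] (S : SignedGraph V) (T : SignedGraph W) (f : V → W)
    (hf : IsSpHom S T f) : chromSp S ≤ Fintype.card W := by
  apply Nat.sInf_le
  let e := Fintype.equivFin W
  refine ⟨⟨T.G.comap e.symm, fun a b => T.sign (e.symm a) (e.symm b), fun a b => T.sign_symm _ _⟩,
    fun v => e (f v), ?_⟩
  intro u v huv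
  simpa using hf u v huv

lemma chromS_le_card {V W : Type} [Fintype W] (S : SignedGraph V) (T : SignedGraph W) (f : V → W)
    (sw : V → Bool)
    (hf : ∀ u v, S.G.Adj u v → T.G.Adj (f u) (f v) ∧
      T.sign (f u) (f v) = (S.sign u v == (sw u == sw v))) : chromS S ≤ Fintype.card W := by
  apply Nat.sInf_le
  let e := Fintype.equivFin W
  let T' : SignedGraph (Fin (Fintype.card W)) :=
    ⟨T.G.comap e.symm, fun a b => T.sign (e.symm a) (e.symm b), fun a b => T.sign_symm _ _⟩
  have hadj : ∀ u v, S.G.Adj u v → T'.G.Adj (e (f u)) (e (f v)) := by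
    intro u v huv
    simpa [T'] using (hf u v huv).1
  have key : ∀ (u v : V) (w : S.G.Walk u v),
      T'.walkSign (w.map ⟨fun v => e (f v), fun {a b} h => hadj a b h⟩) =
        (S.walkSign w == (sw u == sw v)) := by
    intro u v w
    induction w with
    | nil => simp [walkSign]
    | cons h p ih =>
      rename_i a b d
      have h1 : T'.sign (e (f a)) (e (f b)) = (S.sign a b == (sw a == sw b)) := by
        simpa [T'] using (hf a b h).2
      simp only [walkSign, SimpleGraph.Walk.map_cons, SimpleGraph.Walk.darts_cons, List.map_cons,
        List.foldr_cons] at ih ⊢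
      rw [ih]
      have h2 : T'.sign ((⟨fun v => e (f v), fun {a b} h => hadj a b h⟩ : S.G →g T'.G) a)
        ((⟨fun v => e (f v), fun {a b} h => hadj a b h⟩ : S.G →g T'.G) b) =
          (S.sign a b == (sw a == sw b)) := h1
      rw [h2]
      generalize List.foldr _ _ _ = X
      generalize S.sign a b = Y
      cases X <;> cases Y <;> cases sw a <;> cases sw b <;> cases sw d <;> rfl
  refine ⟨T', fun v => e (f v), hadj, ?_⟩
  intro u w
  rw [key]
  simp

/-- The universal target on `K` colours. -/
def uni (K : ℕ) (p : Fin K × (Fin K → Bool) → Prop) : SignedGraph {x // p x} where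
  G := { Adj := fun x y => x.1.1 ≠ y.1.1
         symm := ⟨fun _ _ h => h.symm⟩
         loopless := ⟨fun _ h => h rfl⟩ }
  sign := fun x y => (x.1.2 y.1.1 == y.1.2 x.1.1)
  sign_symm := fun x y => by
    cases x.1.2 y.1.1 <;> cases y.1.2 x.1.1 <;> rfl

lemma chrom_of_coloring {V : Type} (S : SignedGraph V) (k : ℕ) (r : V → ℕ) (hr : Function.Injective r)
    (c : V → Fin (k + 2)) (hc : ∀ u v, S.G.Adj u v → c u ≠ c v)
    (hd : ∀ v u u', S.G.Adj u v → S.G.Adj u' v → r u < r v → r u' < r v → c u = c u' → u = u') :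
    chromS S ≤ (k + 2) * 2 ^ k ∧ chromSp S ≤ (k + 2) * 2 ^ (k + 1) := by
  classical
  obtain ⟨s, hs⟩ : ∃ s : V → Fin (k + 2) → Bool, ∀ v, ∀ u, r u < r v → S.G.Adj u v →
      S.sign u v = (s u (c v) == s v (c u)) := by
    apply exists_rec (α := Fin (k + 2) → Bool) r (fun v g a => ∀ u (h : r u < r v), S.G.Adj u v →
      S.sign u v = (g u h (c v) == a (c u)))
    intro v g
    refine ⟨fun j => if h : ∃ u, ∃ (h : r u < r v), S.G.Adj u v ∧ c u = j then
      (g h.choose h.choose_spec.choose (c v) == S.sign h.choose v) else true, ?_⟩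
    intro u h huv
    have hex : ∃ u', ∃ (h : r u' < r v), S.G.Adj u' v ∧ c u' = c u := ⟨u, h, huv, rfl⟩
    have : hex.choose = u := by
      have := hex.choose_spec
      obtain ⟨h1, h2, h3⟩ := this
      exact hd v _ _ h2 huv h1 h h3
    simp only [hex, dif_pos]
    have e : ∀ u' (h' : r u' < r v), u' = u → S.sign u v =
      (g u h (c v) == (g u' h' (c v) == S.sign u' v)) := by
      rintro u' h' rfl
      cases g u' h' (c v) <;> cases S.sign u' v <;> rfl
    exact e _ _ this
  have hs' : ∀ u v, S.G.Adj u v → S.sign u v = (s u (c v) == s v (c u)) := by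
    intro u v huv
    have hne : r u ≠ r v := fun h => huv.ne (hr h)
    rcases lt_or_gt_of_ne hne with h | h
    · exact hs v u h huv
    · rw [S.sign_symm, hs u v h huv.symm]
      cases s u (c v) <;> cases s v (c u) <;> rfl
  constructor
  · let p : Fin (k + 2) × (Fin (k + 2) → Bool) → Prop :=
      fun x => x.2 x.1 = true ∧ x.2 (x.1.succAbove 0) = true
    let sw : V → Bool := fun v => s v ((c v).succAbove 0)
    let f : V → {x // p x} := fun v =>
      ⟨(c v, fun j => if j = c v then true else (s v j == sw v)), by simp [p, sw]⟩
    refine (chromS_le_card S (uni (k + 2) p) f sw ?_).trans ?_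
    · intro u v huv
      refine ⟨hc u v huv, ?_⟩
      have h1 := hc u v huv
      simp only [uni, f, if_neg h1, if_neg h1.symm, hs' u v huv]
      cases s u (c v) <;> cases s v (c u) <;> cases sw u <;> cases sw v <;> rfl
    · let ι : {x // p x} → Fin (k + 2) × (Fin k → Bool) :=
        fun x => (x.1.1, fun j => x.1.2 (x.1.1.succAbove j.succ))
      have hι : Function.Injective ι := by
        rintro ⟨⟨i, a⟩, h1, h2⟩ ⟨⟨i', b⟩, h3, h4⟩ h
        simp only [ι, Prod.mk.injEq] at h
        obtain ⟨rfl, h⟩ := h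
        simp only at h1 h2 h3 h4
        have : a = b := by
          funext j
          rcases Fin.eq_self_or_eq_succAbove i j with rfl | ⟨j, rfl⟩
          · rw [h1, h3]
          · refine Fin.cases ?_ (fun j => ?_) j
            · rw [h2, h4]
            · exact congrFun h j
        subst this
        rfl
      simpa using Fintype.card_le_of_injective ι hι
  · let p : Fin (k + 2) × (Fin (k + 2) → Bool) → Prop :=
      fun x => x.2 x.1 = true
    let f : V → {x // p x} := fun v =>
      ⟨(c v, fun j => if j = c v then true else s v j), by simp [p]⟩
    refine (chromSp_le_card S (uni (k + 2) p) f ?_).trans ?_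
    · intro u v huv
      refine ⟨hc u v huv, ?_⟩
      have h1 := hc u v huv
      simp only [uni, f, if_neg h1, if_neg h1.symm, hs' u v huv]
    · let ι : {x // p x} → Fin (k + 2) × (Fin (k + 1) → Bool) :=
        fun x => (x.1.1, fun j => x.1.2 (x.1.1.succAbove j))
      have hι : Function.Injective ι := by
        rintro ⟨⟨i, a⟩, h1⟩ ⟨⟨i', b⟩, h3⟩ h
        simp only [ι, Prod.mk.injEq] at h
        obtain ⟨rfl, h⟩ := h
        simp only [p] at h1 h3
        have : a = b := by
          funext j
          rcases Fin.eq_self_or_eq_succAbove i j with rfl | ⟨j, rfl⟩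
          · rw [h1, h3]
          · exact congrFun h j
        subst this
        rfl
      simpa using Fintype.card_le_of_injective ι hι

/-- From a weak 2-colouring order to the chromatic bounds. -/
lemma chrom_of_order {V : Type} [Fintype V] (S : SignedGraph V) (k : ℕ) (ρ : V → ℕ)
    (hρ : ∀ v, Set.ncard {u | ρ u ≤ ρ v ∧ (u = v ∨ S.G.Adj u v ∨
      ∃ w, ρ v ≤ ρ w ∧ S.G.Adj w u ∧ S.G.Adj w v)} ≤ k + 2) :
    chromS S ≤ (k + 2) * 2 ^ k ∧ chromSp S ≤ (k + 2) * 2 ^ (k + 1) := by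
  classical
  let e := Fintype.equivFin V
  let N := Fintype.card V
  let r : V → ℕ := fun v => N * ρ v + (e v : ℕ)
  have hlt : ∀ v, (e v : ℕ) < N := fun v => (e v).2
  have hle : ∀ u v, r u < r v → ρ u ≤ ρ v := by
    intro u v h
    by_contra h'
    push Not at h'
    have : N * (ρ v + 1) ≤ N * ρ u := Nat.mul_le_mul_left _ h'
    have := hlt v
    simp only [r] at h
    rw [mul_add] at *
    omega
  have hr : Function.Injective r := by
    intro u v h
    have h1 : (e u : ℕ) = e v := by
      have := congrArg (· % N) h
      simpa [r, Nat.mul_add_mod, Nat.mod_eq_of_lt (hlt _)] using this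
    exact e.injective (Fin.ext h1)
  obtain ⟨c, hc⟩ : ∃ c : V → Fin (k + 2), ∀ v, ∀ u, r u < r v → (S.G.Adj u v ∨
      ∃ w, ρ v ≤ ρ w ∧ S.G.Adj w u ∧ S.G.Adj w v) → c v ≠ c u := by
    apply exists_rec r (fun v g a => ∀ u (h : r u < r v), (S.G.Adj u v ∨
      ∃ w, ρ v ≤ ρ w ∧ S.G.Adj w u ∧ S.G.Adj w v) → a ≠ g u h)
    intro v g
    by_contra hcon
    push Not at hcon
    choose q hq1 hq2 hq3 using hcon
    have hinj : Function.Injective q := by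
      intro a b hab
      rw [hq3 a, hq3 b]
      congr 1
    have hsub : insert v (Set.range q) ⊆ {u | ρ u ≤ ρ v ∧ (u = v ∨ S.G.Adj u v ∨
      ∃ w, ρ v ≤ ρ w ∧ S.G.Adj w u ∧ S.G.Adj w v)} := by
      rintro x (rfl | ⟨a, rfl⟩)
      · exact ⟨le_rfl, Or.inl rfl⟩
      · exact ⟨hle _ _ (hq1 a), Or.inr (hq2 a)⟩
    have h1 := (Set.ncard_le_ncard hsub (Set.toFinite _)).trans (hρ v)
    rw [Set.ncard_insert_of_notMem] at h1
    · rw [← Set.image_univ, Set.ncard_image_of_injective _ hinj, Set.ncard_univ,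
        Nat.card_eq_fintype_card, Fintype.card_fin] at h1
      omega
    · rintro ⟨a, rfl⟩
      exact lt_irrefl _ (hq1 a)
  apply chrom_of_coloring S k r hr c
  · intro u v huv
    have hne : r u ≠ r v := fun h => huv.ne (hr h)
    rcases lt_or_gt_of_ne hne with h | h
    · exact (hc v u h (Or.inl huv)).symm
    · exact hc u v h (Or.inl huv.symm)
  · intro v u u' hu hu' h1 h2 hcc
    by_contra hne
    rcases lt_or_gt_of_ne (fun h => hne (hr h) : r u ≠ r u') with h | h
    · exact hc u' u h (Or.inr ⟨v, hle _ _ h2, hu.symm, hu'.symm⟩) hcc.symm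
    · exact hc u u' h (Or.inr ⟨v, hle _ _ h1, hu'.symm, hu.symm⟩) hcc

end SignedGraph

namespace MinorAux

variable {V : Type} {G : SimpleGraph V}

/-- `l` is the interior of a path from `A` to `B`. -/
def LinkL (G : SimpleGraph V) : Set V → Set V → List V → Prop
  | A, B, [] => ∃ a ∈ A, ∃ b ∈ B, G.Adj a b
  | A, B, v :: l => (∃ a ∈ A, G.Adj a v) ∧ LinkL G {v} B l

lemma LinkL.mono {A A' B : Set V} {l : List V} (h : LinkL G A B l) (hA : A ⊆ A') :
    LinkL G A' B l := by
  cases l with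
  | nil =>
    obtain ⟨a, ha, b, hb, hab⟩ := h
    exact ⟨a, hA ha, b, hb, hab⟩
  | cons v l =>
    obtain ⟨⟨a, ha, hav⟩, h⟩ := h
    exact ⟨⟨a, hA ha, hav⟩, h⟩

lemma linkL_append {B : Set V} {v : V} {l : List V} : ∀ {A : Set V}, 
    (LinkL G A B (l ++ [v]) ↔ LinkL G A {v} l ∧ ∃ b ∈ B, G.Adj v b) := by
  induction l with
  | nil => intro A; simp [LinkL]
  | cons w l ih => intro A; simp [LinkL, ih, and_assoc]

lemma LinkL.symm {B : Set V} {l : List V} : ∀ {A : Set V}, LinkL G A B l → LinkL G B A l.reverse := by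
  induction l with
  | nil =>
    rintro A ⟨a, ha, b, hb, hab⟩
    exact ⟨b, hb, a, ha, hab.symm⟩
  | cons v l ih =>
    rintro A ⟨⟨a, ha, hav⟩, h⟩
    rw [List.reverse_cons, linkL_append]
    exact ⟨ih h, a, ha, hav.symm⟩

/-- The set `I` is the interior of a path from `A` to `B`. -/
def Link (G : SimpleGraph V) (A B I : Set V) : Prop :=
  ∃ l : List V, l.Nodup ∧ {v | v ∈ l} = I ∧ LinkL G A B l

lemma Link.mono_left {A A' B I : Set V} (h : Link G A B I) (hA : A ⊆ A') : Link G A' B I := by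
  obtain ⟨l, h1, h2, h3⟩ := h
  exact ⟨l, h1, h2, h3.mono hA⟩

lemma Link.symm {A B I : Set V} (h : Link G A B I) : Link G B A I := by
  obtain ⟨l, h1, h2, h3⟩ := h
  exact ⟨l.reverse, by simpa using h1, by simpa using h2, h3.symm⟩

lemma Link.mono_right {A B B' I : Set V} (h : Link G A B I) (hB : B ⊆ B') : Link G A B' I :=
  (h.symm.mono_left hB).symm

lemma Link.nonempty_left {A B I : Set V} (h : Link G A B I) : A.Nonempty := by
  obtain ⟨l, h1, h2, h3⟩ := h
  cases l with
  | nil => obtain ⟨a, ha, _⟩ := h3; exact ⟨a, ha⟩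
  | cons v l => obtain ⟨⟨a, ha, _⟩, _⟩ := h3; exact ⟨a, ha⟩

abbrev Conn (G : SimpleGraph V) (A : Set V) : Prop := (G.induce A).Connected

lemma conn_singleton (v : V) : Conn G {v} := by
  have : Subsingleton ({v} : Set V) := by simp
  have : Nonempty ({v} : Set V) := ⟨⟨v, rfl⟩⟩
  exact ⟨fun a b => by rw [Subsingleton.elim a b]⟩

lemma Conn.union_adj {A B : Set V} (hA : Conn G A) (hB : Conn G B) {a b : V} (ha : a ∈ A)
    (hb : b ∈ B) (hab : G.Adj a b) : Conn G (A ∪ B) := by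
  exact SimpleGraph.connected_induce_union hA.preconnected hB.preconnected ha hb hab

lemma Conn.subset_of_closed {D C : Set V} (hD : Conn G D) {x : V} (hx : x ∈ D) (hxC : x ∈ C)
    (hcl : ∀ a ∈ D, a ∈ C → ∀ b ∈ D, G.Adj a b → b ∈ C) : D ⊆ C := by
  intro y hy
  obtain ⟨w⟩ := hD.preconnected ⟨x, hx⟩ ⟨y, hy⟩
  have : ∀ (p q : D) (w : (G.induce D).Walk p q), p.1 ∈ C → q.1 ∈ C := by
    intro p q w
    induction w with
    | nil => exact id
    | cons h p ih =>
      intro hp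
      exact ih (hcl _ (Subtype.prop _) hp _ (Subtype.prop _) h)
  exact this _ _ w hxC

lemma LinkL.extend {B T : Set V} {l : List V} : ∀ {A : Set V}, LinkL G A B l → Conn G A →
    (∃ v ∈ l, v ∈ T) → ∃ l1 v l2, l = l1 ++ v :: l2 ∧ v ∈ T ∧ (∀ u ∈ l1, u ∉ T) ∧
      Conn G (A ∪ ({u | u ∈ l1} ∪ {v})) ∧ LinkL G {v} B l2 := by
  induction l with
  | nil => rintro A _ _ ⟨v, hv, _⟩; simp at hv
  | cons h l ih =>
    rintro A ⟨⟨a, ha, hah⟩, hl⟩ hA ⟨v, hv, hvT⟩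
    by_cases hT : h ∈ T
    · refine ⟨[], h, l, rfl, hT, by simp, ?_, hl⟩
      have := hA.union_adj (conn_singleton h) ha rfl hah
      simpa using this
    · have hv' : v ∈ l := by
        rcases List.mem_cons.1 hv with rfl | h'
        · exact absurd hvT hT
        · exact h'
      obtain ⟨l1, v', l2, rfl, h1, h2, h3, h4⟩ := ih hl (conn_singleton h) ⟨v, hv', hvT⟩
      refine ⟨h :: l1, v', l2, rfl, h1, ?_, ?_, h4⟩
      · intro u hu
        rcases List.mem_cons.1 hu with rfl | h'
        · exact hT
        · exact h2 u h'
      · have := hA.union_adj h3 ha (Or.inl rfl) hah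
        convert this using 2
        ext x
        simp only [List.mem_cons, Set.mem_union, Set.mem_ofPred_eq, Set.mem_singleton_iff]
        tauto

lemma Link.extend {A B T I : Set V} (h : Link G A B I) (hA : Conn G A)
    (hT : (I ∩ T).Nonempty) : ∃ J v I', J ⊆ I ∧ I' ⊆ I ∧ Disjoint J I' ∧ I = J ∪ I' ∧ 
      v ∈ J ∧ v ∈ T ∧ (∀ u ∈ J, u ∈ T → u = v) ∧
      Conn G (A ∪ J) ∧ Link G (A ∪ J) B I' := by
  obtain ⟨l, hn, rfl, hl⟩ := h
  obtain ⟨v, hv, hvT⟩ := hT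
  obtain ⟨l1, v, l2, rfl, h1, h2, h3, h4⟩ := hl.extend hA ⟨v, hv, hvT⟩
  have hn2 := List.nodup_append.1 hn
  have hn3 := List.nodup_cons.1 hn2.2.1
  refine ⟨{u | u ∈ l1} ∪ {v}, v, {u | u ∈ l2}, ?_, ?_, ?_, ?_, ?_, h1, ?_, h3, 
    l2, hn3.2, rfl, h4.mono ?_⟩
  · rintro x (hx | rfl)
    · simp only [Set.mem_ofPred_eq] at hx ⊢; simp [hx]
    · simp
  · intro x hx; simp only [Set.mem_ofPred_eq] at hx ⊢; simp [hx]
  · rw [Set.disjoint_left]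
    rintro x (hx | rfl) hx2
    · exact hn2.2.2 x hx x (List.mem_cons_of_mem _ hx2) rfl
    · exact hn3.1 hx2
  · ext x
    simp only [List.mem_append, List.mem_cons, Set.mem_union, Set.mem_ofPred_eq, Set.mem_singleton_iff]
    tauto
  · exact Or.inr rfl
  · rintro u (hu | rfl) huT
    · exact absurd huT (h2 u hu)
    · rfl
  · exact fun x hx => Or.inr (Or.inr hx)

lemma LinkL.conn {B : Set V} {l : List V} : ∀ {A : Set V}, LinkL G A B l → Conn G A →
    Conn G (A ∪ {u | u ∈ l}) ∧ ∃ a ∈ A ∪ {u | u ∈ l}, ∃ b ∈ B, G.Adj a b := by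
  induction l with
  | nil =>
    rintro A ⟨a, ha, b, hb, hab⟩ hA
    refine ⟨by simpa using hA, a, Or.inl ha, b, hb, hab⟩
  | cons h l ih =>
    rintro A ⟨⟨a, ha, hah⟩, hl⟩ hA
    obtain ⟨h1, a', h2, b, hb, hab⟩ := ih hl (conn_singleton h)
    have e : {u | u ∈ h :: l} = {h} ∪ {u | u ∈ l} := by
      ext x; simp
    rw [e]
    exact ⟨hA.union_adj h1 ha (Or.inl rfl) hah, a', Or.inr h2, b, hb, hab⟩

lemma Link.conn {A B I : Set V} (h : Link G A B I) (hA : Conn G A) :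
    Conn G (A ∪ I) ∧ ∃ a ∈ A ∪ I, ∃ b ∈ B, G.Adj a b := by
  obtain ⟨l, hn, rfl, hl⟩ := h
  exact hl.conn hA

lemma conn_union_family {ι : Type} (A : Set V) (hA : Conn G A) (F : ι → Set V)
    (hF : ∀ i, Conn G (A ∪ F i)) : Conn G (A ∪ ⋃ i, F i) := by
  obtain ⟨⟨a, ha⟩⟩ := hA.nonempty
  refine SimpleGraph.induce_connected_of_patches (G := G) a (Or.inl ha) ?_
  rintro v (hv | hv)
  · exact ⟨A, Set.subset_union_left, ha, hv, hA.preconnected _ _⟩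
  · obtain ⟨i, hi⟩ := Set.mem_iUnion.1 hv
    refine ⟨A ∪ F i, ?_, Or.inl ha, Or.inr hi, (hF i).preconnected _ _⟩
    exact Set.union_subset_union_right _ (Set.subset_iUnion F i)

/-- Outer boundary. -/
def Nb (G : SimpleGraph V) (C : Set V) : Set V := {u | u ∉ C ∧ ∃ v ∈ C, G.Adj u v}

/-- Vertices near `v` through `C`. -/
def near (G : SimpleGraph V) (C : Set V) (v : V) : Set V :=
  {u | u = v ∨ G.Adj u v ∨ ∃ w ∈ C, G.Adj w u ∧ G.Adj w v}

def Spread (G : SimpleGraph V) (C Q : Set V) : Prop := ∀ v ∈ C, (Q ∩ near G C v).ncard ≤ 5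

lemma Spread.mono [Finite V] {C C' Q : Set V} (h : Spread G C Q) (hC : C' ⊆ C) :
    Spread G C' Q := by
  intro v hv
  refine (Set.ncard_le_ncard ?_ (Set.toFinite _)).trans (h v (hC hv))
  rintro u ⟨hu, h1⟩
  refine ⟨hu, ?_⟩
  rcases h1 with h1 | h1 | ⟨w, hw, h1⟩
  · exact Or.inl h1
  · exact Or.inr (Or.inl h1)
  · exact Or.inr (Or.inr ⟨w, hC hw, h1⟩)

lemma spread_of_ncard [Finite V] {C Q : Set V} (h : Q.ncard ≤ 5) : Spread G C Q := fun _ _ =>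
  (Set.ncard_le_ncard Set.inter_subset_left (Set.toFinite _)).trans h

lemma exists_path [Finite V] {C B : Set V} {a t : V} (hC : Conn G C) (ha : a ∈ Nb G C)
    (ht : t ∈ C) (htB : ∃ b ∈ B, G.Adj t b) :
    ∃ I, I ⊆ C ∧ I.Nonempty ∧ Link G {a} B I ∧ Spread G C ({a} ∪ I) := by
  classical
  obtain ⟨haC, s, hs, has⟩ := ha
  let D : Set V := {a} ∪ C
  have hD : Conn G D := (conn_singleton a).union_adj hC rfl hs has
  let H := G.induce D
  let a' : D := ⟨a, Or.inl rfl⟩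
  let d : V → ℕ := fun v => if h : v ∈ D then H.dist a' ⟨v, h⟩ else 0
  have dval : ∀ v (h : v ∈ D), d v = H.dist a' ⟨v, h⟩ := fun v h => by simp only [d, h, dif_pos]
  have d0 : d a = 0 := by rw [dval a (Or.inl rfl)]; exact SimpleGraph.dist_self
  have dpos : ∀ v ∈ C, 0 < d v := by
    intro v hv
    rw [dval v (Or.inr hv)]
    apply hD.pos_dist_of_ne
    intro h
    have : a = v := congrArg Subtype.val h
    exact haC (this ▸ hv)
  have dadj : ∀ u v, u ∈ D → v ∈ D → G.Adj u v → d v ≤ d u + 1 := by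
    intro u v hu hv huv
    rw [dval u hu, dval v hv]
    have h1 : H.Adj ⟨u, hu⟩ ⟨v, hv⟩ := huv
    calc H.dist a' ⟨v, hv⟩ ≤ H.dist a' ⟨u, hu⟩ + H.dist ⟨u, hu⟩ ⟨v, hv⟩ := hD.dist_triangle
      _ = _ := by rw [SimpleGraph.dist_eq_one_iff_adj.2 h1]
  have dpred : ∀ v ∈ C, ∃ u ∈ D, G.Adj u v ∧ d v = d u + 1 := by
    intro v hv
    obtain ⟨w, hw⟩ := hD.exists_walk_length_eq_dist ⟨v, Or.inr hv⟩ a'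
    have step : ∀ (x y : D) (w : H.Walk x y), x ≠ y →
        ∃ u, H.Adj x u ∧ ∃ p : H.Walk u y, w.length = p.length + 1 := by
      intro x y w hxy
      cases w with
      | nil => exact absurd rfl hxy
      | cons h p => exact ⟨_, h, p, rfl⟩
    have hne : (⟨v, Or.inr hv⟩ : D) ≠ a' := by
      intro h
      have : v = a := congrArg Subtype.val h
      exact haC (this ▸ hv)
    obtain ⟨u, h, p, hp⟩ := step _ _ w hne
    rw [hp] at hw
    have hadj : G.Adj u.1 v := SimpleGraph.Adj.symm h
    refine ⟨u.1, u.2, hadj, ?_⟩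
    have hvD : v ∈ D := Or.inr hv
    apply le_antisymm (dadj _ _ u.2 hvD hadj)
    have h1 : d v = H.dist ⟨v, hvD⟩ a' := (dval v hvD).trans SimpleGraph.dist_comm
    have h2 : d u.1 = H.dist u a' := (dval u.1 u.2).trans SimpleGraph.dist_comm
    have h3 : p.length + 1 = H.dist ⟨v, hvD⟩ a' := hw
    rw [h1, h2, ← h3]
    exact Nat.succ_le_succ (SimpleGraph.dist_le p)
  have main : ∀ k, ∀ v ∈ C, d v = k + 1 → ∃ l : List V, (∀ u ∈ l, u ∈ C ∧ d u < k + 1) ∧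
      l.Pairwise (fun x y => d x < d y) ∧ LinkL G {a} {v} l := by
    intro k
    induction k with
    | zero =>
      intro v hv hdv
      obtain ⟨u, hu, huv, hd⟩ := dpred v hv
      have : u = a := by
        rcases hu with h | h
        · exact h
        · have := dpos u h; omega
      subst this
      exact ⟨[], by simp, by simp, u, rfl, v, rfl, huv⟩
    | succ k ih =>
      intro v hv hdv
      obtain ⟨u, hu, huv, hd⟩ := dpred v hv
      have huC : u ∈ C := by
        rcases hu with h | h
        · rw [Set.mem_singleton_iff.1 h] at hd; omega
        · exact h
      obtain ⟨l, h1, h2, h3⟩ := ih u huC (by omega)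
      refine ⟨l ++ [u], ?_, ?_, linkL_append.2 ⟨h3, v, rfl, huv⟩⟩
      · intro x hx
        rcases List.mem_append.1 hx with hx | hx
        · exact ⟨(h1 x hx).1, by have := (h1 x hx).2; omega⟩
        · rw [List.mem_singleton.1 hx]; exact ⟨huC, by omega⟩
      · rw [List.pairwise_append]
        refine ⟨h2, by simp, ?_⟩
        intro x hx y hy
        rw [List.mem_singleton.1 hy]
        have := (h1 x hx).2
        omega
  obtain ⟨l, h1, h2, h3⟩ := main (d t - 1) t ht (by have := dpos t ht; omega)
  have hpw : (l ++ [t]).Pairwise (fun x y => d x < d y) := by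
    rw [List.pairwise_append]
    refine ⟨h2, by simp, ?_⟩
    intro x hx y hy
    rw [List.mem_singleton.1 hy]
    have := (h1 x hx).2
    have := dpos t ht
    omega
  have hsub : ∀ x ∈ l ++ [t], x ∈ C := by
    intro x hx
    rcases List.mem_append.1 hx with hx | hx
    · exact (h1 x hx).1
    · rw [List.mem_singleton.1 hx]; exact ht
  have hpw' : (a :: (l ++ [t])).Pairwise (fun x y => d x < d y) := by
    rw [List.pairwise_cons]
    refine ⟨fun x hx => ?_, hpw⟩
    rw [d0]; exact dpos x (hsub x hx)
  have hinj : ∀ x ∈ a :: (l ++ [t]), ∀ y ∈ a :: (l ++ [t]), d x = d y → x = y := by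
    have hs : (a :: (l ++ [t])).Pairwise (fun x y => d x ≠ d y) := hpw'.imp (fun h => h.ne)
    intro x hx y hy hxy
    by_contra hne
    have : Std.Symm (fun x y : V => d x ≠ d y) := ⟨fun _ _ h => h.symm⟩
    exact hs.forall hx hy hne hxy
  refine ⟨{x | x ∈ l ++ [t]}, hsub, ⟨t, by simp⟩, ⟨l ++ [t], ?_, rfl, linkL_append.2 ⟨h3, htB⟩⟩, ?_⟩
  · exact hpw.imp (fun h h' => by rw [h'] at h; exact lt_irrefl _ h)
  · intro v hv
    have hmem : ∀ x ∈ ({a} ∪ {x | x ∈ l ++ [t]} : Set V), x ∈ a :: (l ++ [t]) := by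
      rintro x (hx | hx)
      · rw [Set.mem_singleton_iff.1 hx]; simp
      · exact List.mem_cons_of_mem _ hx
    have hmemD : ∀ x ∈ ({a} ∪ {x | x ∈ l ++ [t]} : Set V), x ∈ D := by
      rintro x (hx | hx)
      · exact Or.inl hx
      · exact Or.inr (hsub x hx)
    have hvD : v ∈ D := Or.inr hv
    have hmaps : ∀ x ∈ ({a} ∪ {x | x ∈ l ++ [t]} : Set V) ∩ near G C v,
        d x ∈ (Finset.Icc (d v - 2) (d v + 2) : Set ℕ) := by
      rintro x ⟨hx, hn⟩
      have hxD := hmemD x hx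
      simp only [Finset.coe_Icc, Set.mem_Icc]
      rcases hn with rfl | h | ⟨w, hw, hwx, hwv⟩
      · omega
      · have := dadj _ _ hxD hvD h
        have := dadj _ _ hvD hxD h.symm
        omega
      · have hwD : w ∈ D := Or.inr hw
        have := dadj _ _ hxD hwD hwx.symm
        have := dadj _ _ hwD hxD hwx
        have := dadj _ _ hvD hwD hwv.symm
        have := dadj _ _ hwD hvD hwv
        omega
    have := Set.ncard_le_ncard_of_injOn d hmaps
      (fun x hx y hy h => hinj x (hmem x hx.1) y (hmem y hy.1) h) (Finset.finite_toSet _)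
    refine this.trans ?_
    rw [Set.ncard_coe_finset, Nat.card_Icc]
    omega

/-- The state of the decomposition procedure. -/
structure State (G : SimpleGraph V) (m : ℕ) (S C T : Set V) (A : Fin m → Set V)
    (E : Set (Sym2 (Fin m))) (I Q : Sym2 (Fin m) → Set V) : Prop where
  AC : ∀ x, ∀ u ∈ A x, u ∉ C
  IC : ∀ e ∈ E, ∀ u ∈ I e, u ∉ C
  QC : ∀ e, ∀ u ∈ Q e, u ∉ C
  Aconn : ∀ x, (A x).Nonempty → Conn G (A x)
  AA : ∀ x y, x ≠ y → ∀ u ∈ A x, u ∉ A y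
  AI : ∀ x, ∀ e ∈ E, ∀ u ∈ A x, u ∉ I e
  II : ∀ e ∈ E, ∀ e' ∈ E, e ≠ e' → ∀ u ∈ I e, u ∉ I e'
  ne : ∀ x y, s(x, y) ∈ E → x ≠ y
  link : ∀ x y, s(x, y) ∈ E → Link G (A x) (A y) (I s(x, y))
  sub : ∀ x, ∀ u ∈ A x, u ∈ T → ∀ v ∈ A x, v ∈ T → u = v
  cov : ∀ u ∈ T, ∃ x y, x ≠ y ∧ u ∈ Q s(x, y)
  spr : ∀ e, Spread G S (Q e)
  QE : ∀ x y, s(x, y) ∈ E → ∀ u ∈ Q s(x, y), u ∈ T → u ∈ I s(x, y) ∨ u ∈ A x ∨ u ∈ A y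
  QN : ∀ x y, x ≠ y → s(x, y) ∉ E →
    (∀ u ∈ Q s(x, y), u ∈ T → u ∈ A x) ∨ (∀ u ∈ Q s(x, y), u ∈ T → u ∈ A y)

def HasState (G : SimpleGraph V) (m : ℕ) (S C T : Set V) : Prop := ∃ A E I Q, State G m S C T A E I Q

lemma HasState.mono [Finite V] {m : ℕ} {S C T S' C' T' : Set V} (h : HasState G m S C T) (hS : S' ⊆ S)
    (hC : C' ⊆ C) (hT : T' ⊆ T) : HasState G m S' C' T' := by
  obtain ⟨A, E, I, Q, h⟩ := h
  refine ⟨A, E, I, Q, ?_⟩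
  constructor
  · exact fun x u hu hc => h.AC x u hu (hC hc)
  · exact fun x hx u hu hc => h.IC x hx u hu (hC hc)
  · exact fun x u hu hc => h.QC x u hu (hC hc)
  · exact h.Aconn
  · exact h.AA
  · exact h.AI
  · exact h.II
  · exact h.ne
  · exact h.link
  · exact fun x u hu hu' v hv hv' => h.sub x u hu (hT hu') v hv (hT hv')
  · exact fun u hu => h.cov u (hT hu)
  · exact fun e => (h.spr e).mono hS
  · exact fun x y hxy u hu hu' => h.QE x y hxy u hu (hT hu')
  · intro x y hxy hE
    rcases h.QN x y hxy hE with h | h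
    · exact Or.inl fun u hu hu' => h u hu (hT hu')
    · exact Or.inr fun u hu hu' => h u hu (hT hu')

def Bad {m : ℕ} (T : Set V) (A : Fin m → Set V) (E : Set (Sym2 (Fin m))) : Set (Fin m) :=
  {x | (∀ u ∈ A x, u ∉ T) ∧ ∃ y, s(x, y) ∈ E}

lemma exists_noBad {m : ℕ} {S C T : Set V} : ∀ k, ∀ A E I Q, State G m S C T A E I Q →
    (Bad T A E).ncard ≤ k → ∃ A E I Q, State G m S C T A E I Q ∧ Bad T A E = ∅ := by
  classical
  intro k
  induction k with
  | zero =>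
    intro A E I Q h hb
    refine ⟨A, E, I, Q, h, ?_⟩
    exact (Set.ncard_eq_zero (Set.toFinite _)).1 (by omega)
  | succ k ih =>
    intro A E I Q h hb
    by_cases hemp : Bad T A E = ∅
    · exact ⟨A, E, I, Q, h, hemp⟩
    obtain ⟨x, hx, y0, hy0⟩ := Set.nonempty_iff_ne_empty.2 hemp
    have hlt : ∀ A' E', Bad T A' E' ⊆ Bad T A E \ {x} → (Bad T A' E').ncard ≤ k := by
      intro A' E' hs
      have h1 : (Bad T A E \ {x}).ncard < (Bad T A E).ncard :=
        Set.ncard_sdiff_singleton_lt_of_mem (by exact ⟨hx, y0, hy0⟩) (Set.toFinite _)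
      have h2 := Set.ncard_le_ncard hs (Set.toFinite _)
      omega
    by_cases hext : ∃ y, s(x, y) ∈ E ∧ (I s(x, y) ∩ T).Nonempty
    · obtain ⟨y, hy, hT⟩ := hext
      have hL := h.link x y hy
      have hxy := h.ne x y hy
      obtain ⟨J, v, I', hJ, hI', hd, hU, hvJ, hvT, hJT, hconn, hlink⟩ :=
        hL.extend (h.Aconn x hL.nonempty_left) hT
      obtain ⟨A', hA'x, hA'⟩ : ∃ A' : Fin m → Set V, A' x = A x ∪ J ∧ ∀ z, z ≠ x → A' z = A z :=
        ⟨Function.update A x (A x ∪ J), by simp, fun z hz => by simp [hz]⟩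
      obtain ⟨I2, hI2x, hI2⟩ : ∃ I2 : Sym2 (Fin m) → Set V, I2 s(x, y) = I' ∧
          ∀ e, e ≠ s(x, y) → I2 e = I e :=
        ⟨Function.update I s(x, y) I', by simp, fun z hz => by simp [hz]⟩
      have hAs : ∀ z, A z ⊆ A' z := by
        intro z
        by_cases hz : z = x
        · subst hz; rw [hA'x]; exact Set.subset_union_left
        · rw [hA' z hz]
      have hA'mem : ∀ z u, u ∈ A' z → u ∈ A z ∨ (z = x ∧ u ∈ J) := by
        intro z u hu
        by_cases hz : z = x
        · subst hz; rw [hA'x] at hu; exact hu.imp id (fun h => ⟨rfl, h⟩)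
        · rw [hA' z hz] at hu; exact Or.inl hu
      have hI2mem : ∀ e u, u ∈ I2 e → u ∈ I e ∧ u ∉ J ∨ e ≠ s(x, y) ∧ u ∈ I e := by
        intro e u hu
        by_cases he : e = s(x, y)
        · subst he; rw [hI2x] at hu
          exact Or.inl ⟨hI' hu, fun hj => Set.disjoint_left.1 hd hj hu⟩
        · rw [hI2 e he] at hu; exact Or.inr ⟨he, hu⟩
      have hI2s : ∀ e u, u ∈ I2 e → u ∈ I e := by
        intro e u hu
        rcases hI2mem e u hu with h | h
        · exact h.1
        · exact h.2
      apply ih A' E I2 Q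
      · constructor
        · intro z u hu
          rcases hA'mem z u hu with h1 | ⟨_, h1⟩
          · exact h.AC z u h1
          · exact h.IC _ hy u (hJ h1)
        · intro e he u hu
          exact h.IC e he u (hI2s e u hu)
        · exact h.QC
        · intro z hz
          by_cases hzx : z = x
          · subst hzx; rw [hA'x]; exact hconn
          · rw [hA' z hzx] at hz ⊢; exact h.Aconn z hz
        · intro z w hzw u hu hu'
          rcases hA'mem z u hu with h1 | ⟨h2, h1⟩ <;> rcases hA'mem w u hu' with h3 | ⟨h4, h3⟩
          · exact h.AA z w hzw u h1 h3
          · exact h.AI z _ hy u h1 (hJ h3)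
          · exact h.AI w _ hy u h3 (hJ h1)
          · exact hzw (h2.trans h4.symm)
        · intro z e he u hu hu'
          rcases hA'mem z u hu with h1 | ⟨h2, h1⟩
          · exact h.AI z e he u h1 (hI2s e u hu')
          · rcases hI2mem e u hu' with h3 | h3
            · exact h3.2 h1
            · exact h.II e he _ hy h3.1 u h3.2 (hJ h1)
        · intro e he e' he' hne u hu hu'
          exact h.II e he e' he' hne u (hI2s e u hu) (hI2s e' u hu')
        · exact h.ne
        · intro z w hzw
          by_cases he : s(z, w) = s(x, y)
          · rw [he, hI2x]
            rcases Sym2.eq_iff.1 he with ⟨rfl, rfl⟩ | ⟨rfl, rfl⟩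
            · rw [hA'x, hA' _ hxy.symm]; exact hlink
            · rw [hA'x, hA' _ hxy.symm]; exact hlink.symm
          · rw [hI2 _ he]
            exact ((h.link z w hzw).mono_left (hAs z)).mono_right (hAs w)
        · intro z u hu huT v' hv hvT'
          by_cases hz : z = x
          · subst hz
            rw [hA'x] at hu hv
            have e1 : u = v := hJT u (hu.resolve_left fun h' => hx u h' huT) huT
            have e2 : v' = v := hJT v' (hv.resolve_left fun h' => hx v' h' hvT') hvT'
            rw [e1, e2]
          · rw [hA' z hz] at hu hv
            exact h.sub z u hu huT v' hv hvT'
        · exact h.cov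
        · exact h.spr
        · intro z w hzw u hu huT
          rcases h.QE z w hzw u hu huT with h1 | h1 | h1
          · by_cases he : s(z, w) = s(x, y)
            · rw [he] at h1 ⊢
              rw [hI2x]
              rw [hU] at h1
              rcases h1 with h1 | h1
              · right
                have : u ∈ A' x := by rw [hA'x]; exact Or.inr h1
                rcases Sym2.eq_iff.1 he with ⟨rfl, rfl⟩ | ⟨rfl, rfl⟩
                · exact Or.inl this
                · exact Or.inr this
              · exact Or.inl h1
            · rw [hI2 _ he]; exact Or.inl h1
          · exact Or.inr (Or.inl (hAs _ h1))
          · exact Or.inr (Or.inr (hAs _ h1))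
        · intro z w hzw hE
          rcases h.QN z w hzw hE with h1 | h1
          · exact Or.inl fun u hu hu' => hAs _ (h1 u hu hu')
          · exact Or.inr fun u hu hu' => hAs _ (h1 u hu hu')
      · apply hlt
        rintro z ⟨hz1, hz2⟩
        refine ⟨⟨fun u hu => hz1 u (hAs z hu), hz2⟩, ?_⟩
        rintro rfl
        exact hz1 v (by rw [hA'x]; exact Or.inr hvJ) hvT
    · apply ih A {e | e ∈ E ∧ x ∉ e} I Q
      · constructor
        · exact h.AC
        · exact fun e he => h.IC e he.1
        · exact h.QC
        · exact h.Aconn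
        · exact h.AA
        · exact fun z e he => h.AI z e he.1
        · exact fun e he e' he' => h.II e he.1 e' he'.1
        · exact fun z w hzw => h.ne z w hzw.1
        · exact fun z w hzw => h.link z w hzw.1
        · exact h.sub
        · exact h.cov
        · exact h.spr
        · exact fun z w hzw => h.QE z w hzw.1
        · intro z w hzw hE
          by_cases hE' : s(z, w) ∈ E
          · have hxm : x ∈ s(z, w) := by
              by_contra hc
              exact hE ⟨hE', hc⟩
            have hemp : ∀ u ∈ I s(z, w), u ∉ T := by
              intro u hu huT
              apply hext
              rcases Sym2.mem_iff.1 hxm with rfl | rfl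
              · exact ⟨w, hE', u, hu, huT⟩
              · rw [Sym2.eq_swap] at hE' hu
                exact ⟨z, hE', u, hu, huT⟩
            rcases Sym2.mem_iff.1 hxm with rfl | rfl
            · right
              intro u hu huT
              rcases h.QE _ _ hE' u hu huT with h1 | h1 | h1
              · exact absurd huT (hemp u h1)
              · exact absurd huT (hx u h1)
              · exact h1
            · left
              intro u hu huT
              rcases h.QE _ _ hE' u hu huT with h1 | h1 | h1
              · exact absurd huT (hemp u h1)
              · exact h1
              · exact absurd huT (hx u h1)
          · exact h.QN z w hzw hE'
      · apply hlt
        rintro z ⟨hz1, w, hw⟩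
        refine ⟨⟨hz1, w, hw.1⟩, ?_⟩
        rintro rfl
        exact hw.2 (Sym2.mem_mk_left _ _)

lemma minor_of_state {m : ℕ} {C : Set V} {A E I Q} (hC : Conn G C)
    (h : State G m C C (Nb G C) A E I Q) (hal : ∀ x, ∃ u ∈ A x, u ∈ Nb G C)
    (hE : ∀ x y, x ≠ y → s(x, y) ∈ E) : G.HasCompleteMinor (m + 1) := by
  classical
  have hne : ∀ x, (A x).Nonempty := fun x => by
    obtain ⟨u, hu, _⟩ := hal x
    exact ⟨u, hu⟩
  let F : Fin m → Set V := fun x => A x ∪ ⋃ y : {y // x < y}, I s(x, y.1)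
  have hFmem : ∀ x u, u ∈ F x → u ∈ A x ∨ ∃ y, x < y ∧ u ∈ I s(x, y) := by
    rintro x u (hu | hu)
    · exact Or.inl hu
    · obtain ⟨⟨y, hy⟩, hi⟩ := Set.mem_iUnion.1 hu
      exact Or.inr ⟨y, hy, hi⟩
  have hFconn : ∀ x, Conn G (F x) := by
    intro x
    apply conn_union_family _ (h.Aconn x (hne x))
    rintro ⟨y, hy⟩
    exact ((h.link x y (hE x y hy.ne)).conn (h.Aconn x (hne x))).1
  have hFadj' : ∀ x y, x < y → ∃ u ∈ F x, ∃ v ∈ F y, G.Adj u v := by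
    intro x y hxy
    obtain ⟨a, ha, b, hb, hab⟩ := ((h.link x y (hE x y hxy.ne)).conn (h.Aconn x (hne x))).2
    refine ⟨a, ?_, b, Or.inl hb, hab⟩
    rcases ha with ha | ha
    · exact Or.inl ha
    · exact Or.inr (Set.mem_iUnion.2 ⟨⟨y, hxy⟩, ha⟩)
  have hFadj : ∀ x y, x ≠ y → ∃ u ∈ F x, ∃ v ∈ F y, G.Adj u v := by
    intro x y hxy
    rcases lt_or_gt_of_ne hxy with h1 | h1
    · exact hFadj' x y h1
    · obtain ⟨a, ha, b, hb, hab⟩ := hFadj' y x h1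
      exact ⟨b, hb, a, ha, hab.symm⟩
  have hFdisj : ∀ x y, x ≠ y → Disjoint (F x) (F y) := by
    intro x y hxy
    rw [Set.disjoint_left]
    intro u hu hu'
    rcases hFmem x u hu with h1 | ⟨z, hz, h1⟩ <;> rcases hFmem y u hu' with h2 | ⟨w, hw, h2⟩
    · exact h.AA x y hxy u h1 h2
    · exact h.AI x _ (hE _ _ hw.ne) u h1 h2
    · exact h.AI y _ (hE _ _ hz.ne) u h2 h1
    · refine h.II _ (hE _ _ hz.ne) _ (hE _ _ hw.ne) ?_ u h1 h2
      intro he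
      rcases Sym2.eq_iff.1 he with ⟨rfl, rfl⟩ | ⟨rfl, rfl⟩
      · exact hxy rfl
      · exact lt_asymm hz hw
  have hFC : ∀ x, Disjoint (F x) C := by
    intro x
    rw [Set.disjoint_left]
    intro u hu
    rcases hFmem x u hu with h1 | ⟨z, hz, h1⟩
    · exact h.AC x u h1
    · exact h.IC _ (hE _ _ hz.ne) u h1
  have hFCadj : ∀ x, ∃ u ∈ F x, ∃ v ∈ C, G.Adj u v := by
    intro x
    obtain ⟨u, hu, _, v, hv, huv⟩ := hal x
    exact ⟨u, Or.inl hu, v, hv, huv⟩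
  have hFne : ∀ x, (F x).Nonempty := fun x => (hne x).mono Set.subset_union_left
  have hCne : C.Nonempty := by
    obtain ⟨⟨c, hc⟩⟩ := hC.nonempty
    exact ⟨c, hc⟩
  refine ⟨Fin.cases C F, ?_, ?_, ?_, ?_⟩
  · intro i
    refine Fin.cases hCne hFne i
  · intro i
    refine Fin.cases hC hFconn i
  · intro i j
    refine Fin.cases ?_ (fun x => ?_) i <;> refine Fin.cases ?_ (fun y => ?_) j
    · intro h; exact absurd rfl h
    · intro _; exact (hFC y).symm
    · intro _; exact hFC x
    · intro h; exact hFdisj x y (fun h' => h (by rw [h']))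
  · intro i j
    refine Fin.cases ?_ (fun x => ?_) i <;> refine Fin.cases ?_ (fun y => ?_) j
    · intro h; exact absurd rfl h
    · intro _
      obtain ⟨a, ha, b, hb, hab⟩ := hFCadj y
      exact ⟨b, hb, a, ha, hab.symm⟩
    · intro _; exact hFCadj x
    · intro h; exact hFadj x y (fun h' => h (by rw [h']))

/-- Adding a path between two live bags. -/
lemma step_path [Finite V] {m : ℕ} {C : Set V} {A E I Q} (hC : Conn G C)
    (h : State G m C C (Nb G C) A E I Q) {x y : Fin m} (hxy : x ≠ y) (hE : s(x, y) ∉ E)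
    (hx : ∃ u ∈ A x, u ∈ Nb G C) (hy : ∃ u ∈ A y, u ∈ Nb G C)
    (hQ : ∀ u ∈ Q s(x, y), u ∈ Nb G C → u ∈ A x) :
    ∃ P ⊆ C, P.Nonempty ∧ HasState G m C (C \ P) (Nb G C ∪ P) := by
  classical
  obtain ⟨a, haA, haN⟩ := hx
  obtain ⟨b, hbA, hbC, t, ht, hbt⟩ := hy
  obtain ⟨P, hPC, hPne, hL, hS⟩ := exists_path (B := A y) hC haN ht ⟨b, hbA, hbt.symm⟩
  refine ⟨P, hPC, hPne, ?_⟩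
  have hL' : Link G (A x) (A y) P := hL.mono_left (by simpa using haA)
  have hAP : ∀ z, ∀ u ∈ A z, u ∉ P := fun z u hu hP => h.AC z u hu (hPC hP)
  have hIP : ∀ e ∈ E, ∀ u ∈ I e, u ∉ P := fun e he u hu hP => h.IC e he u hu (hPC hP)
  have hQP : ∀ e, ∀ u ∈ Q e, u ∉ P := fun e u hu hP => h.QC e u hu (hPC hP)
  obtain ⟨I2, hI2x, hI2⟩ : ∃ I2 : Sym2 (Fin m) → Set V, I2 s(x, y) = P ∧
      ∀ e, e ≠ s(x, y) → I2 e = I e :=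
    ⟨Function.update I s(x, y) P, by simp, fun z hz => by simp [hz]⟩
  obtain ⟨Q2, hQ2x, hQ2⟩ : ∃ Q2 : Sym2 (Fin m) → Set V, Q2 s(x, y) = {a} ∪ P ∧
      ∀ e, e ≠ s(x, y) → Q2 e = Q e :=
    ⟨Function.update Q s(x, y) ({a} ∪ P), by simp, fun z hz => by simp [hz]⟩
  have hI2m : ∀ e ∈ insert s(x, y) E, ∀ u ∈ I2 e, (e = s(x, y) ∧ u ∈ P) ∨
      (e ∈ E ∧ e ≠ s(x, y) ∧ u ∈ I e) := by
    intro e he u hu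
    by_cases h1 : e = s(x, y)
    · subst h1; rw [hI2x] at hu; exact Or.inl ⟨rfl, hu⟩
    · rw [hI2 e h1] at hu; exact Or.inr ⟨he.resolve_left h1, h1, hu⟩
  refine ⟨A, insert s(x, y) E, I2, Q2, ?_⟩
  constructor
  · exact fun z u hu hc => h.AC z u hu hc.1
  · intro e he u hu hc
    rcases hI2m e he u hu with h1 | h1
    · exact hc.2 h1.2
    · exact h.IC e h1.1 u h1.2.2 hc.1
  · intro e u hu hc
    by_cases h1 : e = s(x, y)
    · subst h1; rw [hQ2x] at hu
      rcases hu with hu | hu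
      · rw [Set.mem_singleton_iff.1 hu] at hc; exact haN.1 hc.1
      · exact hc.2 hu
    · rw [hQ2 e h1] at hu; exact h.QC e u hu hc.1
  · exact h.Aconn
  · exact h.AA
  · intro z e he u hu hu'
    rcases hI2m e he u hu' with h1 | h1
    · exact hAP z u hu h1.2
    · exact h.AI z e h1.1 u hu h1.2.2
  · intro e he e' he' hne u hu hu'
    rcases hI2m e he u hu with h1 | h1 <;> rcases hI2m e' he' u hu' with h2 | h2
    · exact hne (h1.1.trans h2.1.symm)
    · exact hIP e' h2.1 u h2.2.2 h1.2
    · exact hIP e h1.1 u h1.2.2 h2.2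
    · exact h.II e h1.1 e' h2.1 hne u h1.2.2 h2.2.2
  · intro z w hzw
    rcases hzw with h1 | h1
    · rcases Sym2.eq_iff.1 h1 with ⟨rfl, rfl⟩ | ⟨rfl, rfl⟩
      · exact hxy
      · exact hxy.symm
    · exact h.ne z w h1
  · intro z w hzw
    by_cases he : s(z, w) = s(x, y)
    · rw [he, hI2x]
      rcases Sym2.eq_iff.1 he with ⟨rfl, rfl⟩ | ⟨rfl, rfl⟩
      · exact hL'
      · exact hL'.symm
    · rw [hI2 _ he]
      exact h.link z w (hzw.resolve_left he)
  · intro z u hu huT v hv hvT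
    exact h.sub z u hu (huT.resolve_right (hAP z u hu)) v hv (hvT.resolve_right (hAP z v hv))
  · rintro u (hu | hu)
    · obtain ⟨z, w, hzw, hq⟩ := h.cov u hu
      by_cases he : s(z, w) = s(x, y)
      · refine ⟨x, y, hxy, ?_⟩
        rw [he] at hq
        rw [hQ2x, h.sub x u (hQ u hq hu) hu a haA haN]
        exact Or.inl rfl
      · exact ⟨z, w, hzw, by rw [hQ2 _ he]; exact hq⟩
    · exact ⟨x, y, hxy, by rw [hQ2x]; exact Or.inr hu⟩
  · intro e
    by_cases h1 : e = s(x, y)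
    · rw [h1, hQ2x]; exact hS
    · rw [hQ2 e h1]; exact h.spr e
  · intro z w hzw u hu huT
    by_cases he : s(z, w) = s(x, y)
    · rw [he] at hu ⊢
      rw [hQ2x] at hu
      rw [hI2x]
      rcases hu with hu | hu
      · rw [Set.mem_singleton_iff.1 hu]
        rcases Sym2.eq_iff.1 he with ⟨rfl, rfl⟩ | ⟨rfl, rfl⟩
        · exact Or.inr (Or.inl haA)
        · exact Or.inr (Or.inr haA)
      · exact Or.inl hu
    · rw [hQ2 _ he] at hu
      rw [hI2 _ he]
      exact h.QE z w (hzw.resolve_left he) u hu (huT.resolve_right (hQP _ u hu))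
  · intro z w hzw hE'
    have he : s(z, w) ≠ s(x, y) := fun h' => hE' (Or.inl h')
    rw [hQ2 _ he]
    rcases h.QN z w hzw (fun h' => hE' (Or.inr h')) with h1 | h1
    · exact Or.inl fun u hu hu' => h1 u hu (hu'.resolve_right (hQP _ u hu))
    · exact Or.inr fun u hu hu' => h1 u hu (hu'.resolve_right (hQP _ u hu))

/-- Starting a new bag `z` next to a live bag `x`. -/
lemma step_new [Finite V] {m : ℕ} {C : Set V} {A E I Q}
    (h : State G m C C (Nb G C) A E I Q) {x z : Fin m} (hxz : x ≠ z) (hE : ∀ y, s(z, y) ∉ E)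
    (hx : ∃ u ∈ A x, u ∈ Nb G C) (hz : ∀ u ∈ A z, u ∉ Nb G C) :
    ∃ P ⊆ C, P.Nonempty ∧ HasState G m C (C \ P) (Nb G C ∪ P) := by
  classical
  obtain ⟨a, haA, haN⟩ := hx
  obtain ⟨haC, p, hp, hap⟩ := id haN
  refine ⟨{p}, by simpa using hp, ⟨p, rfl⟩, ?_⟩
  have hAP : ∀ z, p ∉ A z := fun z hP => h.AC z p hP hp
  have hIP : ∀ e ∈ E, p ∉ I e := fun e he hP => h.IC e he p hP hp
  have hQP : ∀ e, p ∉ Q e := fun e hP => h.QC e p hP hp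
  have hQP' : ∀ e u, u ∈ Q e → u ∈ Nb G C ∪ {p} → u ∈ Nb G C := by
    intro e u hu hu'
    refine hu'.resolve_right fun h1 => ?_
    rw [Set.mem_singleton_iff.1 h1] at hu
    exact hQP e hu
  have hexz : s(x, z) ∉ E := by rw [Sym2.eq_swap]; exact hE x
  obtain ⟨A2, hA2z, hA2⟩ : ∃ A2 : Fin m → Set V, A2 z = {p} ∧ ∀ w, w ≠ z → A2 w = A w :=
    ⟨Function.update A z {p}, by simp, fun w hw => by simp [hw]⟩
  obtain ⟨I2, hI2x, hI2⟩ : ∃ I2 : Sym2 (Fin m) → Set V, I2 s(x, z) = ∅ ∧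
      ∀ e, e ≠ s(x, z) → I2 e = I e :=
    ⟨Function.update I s(x, z) ∅, by simp, fun z hz => by simp [hz]⟩
  obtain ⟨Q2, hQ2x, hQ2⟩ : ∃ Q2 : Sym2 (Fin m) → Set V, Q2 s(x, z) = {a, p} ∧
      ∀ e, e ≠ s(x, z) → Q2 e = Q e :=
    ⟨Function.update Q s(x, z) ({a, p}), by simp, fun z hz => by simp [hz]⟩
  have hI2m : ∀ e ∈ insert s(x, z) E, ∀ u ∈ I2 e, e ∈ E ∧ u ∈ I e := by
    intro e he u hu
    by_cases h1 : e = s(x, z)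
    · subst h1; rw [hI2x] at hu; exact absurd hu (Set.notMem_empty u)
    · rw [hI2 e h1] at hu; exact ⟨he.resolve_left h1, hu⟩
  have hA2m : ∀ w u, u ∈ A2 w → (w = z ∧ u = p) ∨ (w ≠ z ∧ u ∈ A w) := by
    intro w u hu
    by_cases h1 : w = z
    · subst h1; rw [hA2z] at hu; exact Or.inl ⟨rfl, hu⟩
    · rw [hA2 w h1] at hu; exact Or.inr ⟨h1, hu⟩
  have hL : Link G (A2 x) (A2 z) ∅ := by
    rw [hA2z, hA2 x hxz]
    exact ⟨[], by simp, by simp, a, haA, p, rfl, hap⟩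
  have hnz : ∀ v w, s(v, w) ∈ E → v ≠ z ∧ w ≠ z := by
    intro v w hvw
    constructor
    · rintro rfl; exact hE w hvw
    · rintro rfl; rw [Sym2.eq_swap] at hvw; exact hE v hvw
  have hQN : ∀ v w, v ≠ w → s(v, w) ∉ E → (∀ u ∈ Q s(v, w), u ∈ Nb G C → v ≠ z ∧ u ∈ A v) ∨
      (∀ u ∈ Q s(v, w), u ∈ Nb G C → w ≠ z ∧ u ∈ A w) := by
    intro v w hvw hvE
    rcases h.QN v w hvw hvE with h1 | h1
    · refine Or.inl fun u hu hu' => ⟨?_, h1 u hu hu'⟩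
      rintro rfl
      exact hz u (h1 u hu hu') hu'
    · refine Or.inr fun u hu hu' => ⟨?_, h1 u hu hu'⟩
      rintro rfl
      exact hz u (h1 u hu hu') hu'
  refine ⟨A2, insert s(x, z) E, I2, Q2, ?_⟩
  constructor
  · intro w u hu hc
    rcases hA2m w u hu with h1 | h1
    · exact hc.2 h1.2
    · exact h.AC w u h1.2 hc.1
  · intro e he u hu hc
    have h1 := hI2m e he u hu
    exact h.IC e h1.1 u h1.2 hc.1
  · intro e u hu hc
    by_cases h1 : e = s(x, z)
    · subst h1; rw [hQ2x] at hu
      rcases hu with hu | hu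
      · rw [hu] at hc; exact haN.1 hc.1
      · exact hc.2 hu
    · rw [hQ2 e h1] at hu; exact h.QC e u hu hc.1
  · intro w hw
    by_cases h1 : w = z
    · subst h1; rw [hA2z]; exact conn_singleton p
    · rw [hA2 w h1] at hw ⊢; exact h.Aconn w hw
  · intro v w hvw u hu hu'
    rcases hA2m v u hu with h1 | h1 <;> rcases hA2m w u hu' with h2 | h2
    · exact hvw (h1.1.trans h2.1.symm)
    · exact hAP w (h1.2 ▸ h2.2)
    · exact hAP v (h2.2 ▸ h1.2)
    · exact h.AA v w hvw u h1.2 h2.2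
  · intro w e he u hu hu'
    have h1 := hI2m e he u hu'
    rcases hA2m w u hu with h2 | h2
    · exact hIP e h1.1 (h2.2 ▸ h1.2)
    · exact h.AI w e h1.1 u h2.2 h1.2
  · intro e he e' he' hne u hu hu'
    have h1 := hI2m e he u hu
    have h2 := hI2m e' he' u hu'
    exact h.II e h1.1 e' h2.1 hne u h1.2 h2.2
  · intro v w hvw
    rcases hvw with h1 | h1
    · rcases Sym2.eq_iff.1 h1 with ⟨rfl, rfl⟩ | ⟨rfl, rfl⟩
      · exact hxz
      · exact hxz.symm
    · exact h.ne v w h1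
  · intro v w hvw
    by_cases he : s(v, w) = s(x, z)
    · rw [he, hI2x]
      rcases Sym2.eq_iff.1 he with ⟨rfl, rfl⟩ | ⟨rfl, rfl⟩
      · exact hL
      · exact hL.symm
    · have hE' := hvw.resolve_left he
      have h1 := hnz v w hE'
      rw [hI2 _ he, hA2 v h1.1, hA2 w h1.2]
      exact h.link v w hE'
  · intro w u hu huT v hv hvT
    rcases hA2m w u hu with h1 | h1 <;> rcases hA2m w v hv with h2 | h2
    · rw [h1.2, h2.2]
    · exact absurd h1.1 h2.1
    · exact absurd h2.1 h1.1
    · refine h.sub w u h1.2 (huT.resolve_right ?_) v h2.2 (hvT.resolve_right ?_)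
      · intro h3; rw [Set.mem_singleton_iff.1 h3] at h1; exact hAP w h1.2
      · intro h3; rw [Set.mem_singleton_iff.1 h3] at h2; exact hAP w h2.2
  · rintro u (hu | hu)
    · obtain ⟨v, w, hvw, hq⟩ := h.cov u hu
      by_cases he : s(v, w) = s(x, z)
      · refine ⟨x, z, hxz, ?_⟩
        rw [he] at hq
        have hux : u ∈ A x := by
          rcases hQN x z hxz hexz with h1 | h1
          · exact (h1 u hq hu).2
          · exact absurd rfl (h1 u hq hu).1
        rw [hQ2x, h.sub x u hux hu a haA haN]
        exact Or.inl rfl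
      · exact ⟨v, w, hvw, by rw [hQ2 _ he]; exact hq⟩
    · exact ⟨x, z, hxz, by rw [hQ2x]; exact Or.inr hu⟩
  · intro e
    by_cases h1 : e = s(x, z)
    · rw [h1, hQ2x]
      exact spread_of_ncard ((Set.ncard_insert_le _ _).trans (by simp))
    · rw [hQ2 e h1]; exact h.spr e
  · intro v w hvw u hu huT
    by_cases he : s(v, w) = s(x, z)
    · rw [he] at hu ⊢
      rw [hQ2x] at hu
      right
      have : u ∈ A2 x ∨ u ∈ A2 z := by
        rcases hu with hu | hu
        · left; rw [hA2 x hxz, hu]; exact haA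
        · right; rw [hA2z]; exact hu
      rcases Sym2.eq_iff.1 he with ⟨rfl, rfl⟩ | ⟨rfl, rfl⟩
      · exact this
      · exact this.symm
    · have hE' := hvw.resolve_left he
      have h1 := hnz v w hE'
      rw [hQ2 _ he] at hu
      rw [hI2 _ he, hA2 v h1.1, hA2 w h1.2]
      exact h.QE v w hE' u hu (hQP' _ u hu huT)
  · intro v w hvw hE'
    have he : s(v, w) ≠ s(x, z) := fun h' => hE' (Or.inl h')
    rw [hQ2 _ he]
    rcases hQN v w hvw (fun h' => hE' (Or.inr h')) with h1 | h1
    · left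
      intro u hu hu'
      have h2 := h1 u hu (hQP' _ u hu hu')
      rw [hA2 v h2.1]; exact h2.2
    · right
      intro u hu hu'
      have h2 := h1 u hu (hQP' _ u hu hu')
      rw [hA2 w h2.1]; exact h2.2

/-- Starting afresh when the boundary is empty. -/
lemma step_fresh [Finite V] {m : ℕ} (hm : 2 ≤ m) {C : Set V} (hC : Conn G C) (hN : Nb G C = ∅) :
    ∃ P ⊆ C, P.Nonempty ∧ HasState G m C (C \ P) (Nb G C ∪ P) := by
  classical
  obtain ⟨⟨p, hp⟩⟩ := hC.nonempty
  refine ⟨{p}, by simpa using hp, ⟨p, rfl⟩, ?_⟩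
  rw [hN, Set.empty_union]
  let x : Fin m := ⟨0, by omega⟩
  let z : Fin m := ⟨1, by omega⟩
  have hxz : x ≠ z := by simp [x, z]
  refine ⟨fun w => if w = x then {p} else ∅, ∅, fun _ => ∅,
    fun e => if e = s(x, z) then {p} else ∅, ?_⟩
  have key : ∀ {P : Prop} [Decidable P] (u : V), u ∈ (if P then {p} else ∅ : Set V) → P ∧ u = p := by
    intro P _ u hu
    split_ifs at hu with h
    · exact ⟨h, hu⟩
    · exact absurd hu (Set.notMem_empty u)
  constructor
  · intro w u hu hc; exact hc.2 (key u hu).2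
  · simp
  · intro w u hu hc; exact hc.2 (key u hu).2
  · rintro w ⟨u, hu⟩
    simp only [(key u hu).1, if_true]
    exact conn_singleton p
  · intro v w hvw u hu hu'
    exact hvw ((key u hu).1.trans (key u hu').1.symm)
  · simp
  · simp
  · simp
  · simp
  · intro w u hu _ v hv _
    rw [(key u hu).2, (key v hv).2]
  · intro u hu
    exact ⟨x, z, hxz, by simpa using hu⟩
  · intro e
    apply spread_of_ncard
    split_ifs <;> simp
  · simp
  · intro v w hvw _
    by_cases hv : v = x
    · left
      intro u hu hu'
      simp only [hv, if_true]; exact hu'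
    · right
      intro u hu hu'
      have h1 := (key u hu).1
      have : w = x := by
        rcases Sym2.eq_iff.1 h1 with h2 | h2
        · exact absurd h2.1 hv
        · exact h2.2
      simp only [this, if_true]; exact hu'

lemma step [Finite V] {m : ℕ} (hm : 2 ≤ m) (hno : ¬ G.HasCompleteMinor (m + 1)) {C : Set V}
    (hC : Conn G C) (h : HasState G m C C (Nb G C)) :
    ∃ P ⊆ C, P.Nonempty ∧ HasState G m C (C \ P) (Nb G C ∪ P) := by
  classical
  obtain ⟨A, E, I, Q, h⟩ := h
  obtain ⟨A, E, I, Q, h, hbad⟩ := exists_noBad _ A E I Q h le_rfl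
  have hb : ∀ x, (∀ u ∈ A x, u ∉ Nb G C) → ∀ y, s(x, y) ∉ E := by
    intro x hx y hy
    have : x ∈ Bad (Nb G C) A E := ⟨hx, y, hy⟩
    rw [hbad] at this
    exact this
  by_cases hal : ∀ x, ∃ u ∈ A x, u ∈ Nb G C
  · by_cases hE : ∀ x y, x ≠ y → s(x, y) ∈ E
    · exact absurd (minor_of_state hC h hal hE) hno
    · push Not at hE
      obtain ⟨x, y, hxy, hE⟩ := hE
      rcases h.QN x y hxy hE with h1 | h1
      · exact step_path hC h hxy hE (hal x) (hal y) h1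
      · rw [Sym2.eq_swap] at hE h1
        exact step_path hC h hxy.symm hE (hal y) (hal x) h1
  · push Not at hal
    obtain ⟨z, hz⟩ := hal
    by_cases hx : ∃ x, ∃ u ∈ A x, u ∈ Nb G C
    · obtain ⟨x, hx⟩ := hx
      have hxz : x ≠ z := by
        rintro rfl
        obtain ⟨u, hu, hu'⟩ := hx
        exact hz u hu hu'
      exact step_new h hxz (hb z hz) hx hz
    · push Not at hx
      apply step_fresh hm hC
      rw [Set.eq_empty_iff_forall_notMem]
      intro u hu
      obtain ⟨x, y, hxy, hq⟩ := h.cov u hu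
      rcases h.QN x y hxy (hb x (hx x) y) with h1 | h1
      · exact hx x u (h1 u hq hu) hu
      · exact hx y u (h1 u hq hu) hu

/-- `C` is (the vertex set of) a connected component of the subgraph induced by `U`. -/
def IsComp (G : SimpleGraph V) (U C : Set V) : Prop :=
  C ⊆ U ∧ Conn G C ∧ ∀ a ∈ C, ∀ b ∈ U, G.Adj a b → b ∈ C

lemma exists_comp [Finite V] {U : Set V} {v : V} (hv : v ∈ U) : ∃ C, IsComp G U C ∧ v ∈ C := by
  obtain ⟨C, hC⟩ := (Set.toFinite {C : Set V | C ⊆ U ∧ Conn G C ∧ v ∈ C}).exists_maximal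
    ⟨{v}, by simpa using hv, conn_singleton v, rfl⟩
  obtain ⟨h1, h2, h3⟩ := hC.prop
  refine ⟨C, ⟨h1, h2, fun a ha b hb hab => ?_⟩, h3⟩
  have h4 : C ∪ {b} ∈ {C : Set V | C ⊆ U ∧ Conn G C ∧ v ∈ C} := by
    refine ⟨Set.union_subset h1 (by simpa using hb), h2.union_adj (conn_singleton b) ha rfl hab, Or.inl h3⟩
  exact hC.le_of_ge h4 Set.subset_union_left (Or.inr rfl)

lemma HasState.ncard_le [Finite V] {m : ℕ} {S C T : Set V} (h : HasState G m S C T) {v : V}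
    (hv : v ∈ S) : (T ∩ near G S v).ncard ≤ 5 * Nat.choose m 2 := by
  classical
  obtain ⟨A, E, I, Q, h⟩ := h
  have hsub : T ∩ near G S v ⊆ ⋃ e ∈ (Finset.univ : Finset {e : Sym2 (Fin m) // ¬ e.IsDiag}),
      (Q e.1 ∩ near G S v) := by
    rintro u ⟨hu, hu'⟩
    obtain ⟨x, y, hxy, hq⟩ := h.cov u hu
    simp only [Finset.mem_univ, Set.iUnion_true, Set.mem_iUnion]
    exact ⟨⟨s(x, y), by simpa using hxy⟩, hq, hu'⟩
  calc _ ≤ _ := Set.ncard_le_ncard hsub (Set.toFinite _)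
    _ ≤ ∑ e ∈ (Finset.univ : Finset {e : Sym2 (Fin m) // ¬ e.IsDiag}), (Q e.1 ∩ near G S v).ncard :=
        Finset.set_ncard_biUnion_le _ _
    _ ≤ ∑ e ∈ (Finset.univ : Finset {e : Sym2 (Fin m) // ¬ e.IsDiag}), 5 :=
        Finset.sum_le_sum fun e _ => h.spr e.1 v hv
    _ = 5 * Nat.choose m 2 := by
        rw [Finset.sum_const, Finset.card_univ, Sym2.card_subtype_not_diag]
        simp [mul_comm]

lemma exists_order [Finite V] {m : ℕ} (hm : 2 ≤ m) (hno : ¬ G.HasCompleteMinor (m + 1)) :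
    ∀ (N : ℕ) (U : Set V), U.ncard ≤ N →
    (∀ C, IsComp G U C → HasState G m C C (Nb G C)) →
    ∃ ρ : V → ℕ, ∀ v ∈ U, Set.ncard {u | (u ∉ U ∨ ρ u ≤ ρ v) ∧
      (u = v ∨ G.Adj u v ∨ ∃ w ∈ U, ρ v ≤ ρ w ∧ G.Adj w u ∧ G.Adj w v)} ≤ 5 * Nat.choose m 2 := by
  classical
  intro N
  induction N with
  | zero =>
    intro U hU _
    have : U = ∅ := (Set.ncard_eq_zero (Set.toFinite U)).1 (by omega)
    subst this
    exact ⟨fun _ => 0, by simp⟩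
  | succ N ih =>
    intro U hU hst
    rcases U.eq_empty_or_nonempty with rfl | ⟨v0, hv0⟩
    · exact ⟨fun _ => 0, by simp⟩
    obtain ⟨C, hC, hv0C⟩ := exists_comp (G := G) hv0
    obtain ⟨P, hPC, ⟨p, hp⟩, hP⟩ := step hm hno hC.2.1 (hst C hC)
    have hPU : P ⊆ U := hPC.trans hC.1
    obtain ⟨ρ, hρ⟩ := ih (U \ P) (by
      have : (U \ P).ncard < U.ncard := by
        apply Set.ncard_lt_ncard _ (Set.toFinite _)
        refine ⟨Set.diff_subset, fun h => (h (hPU hp)).2 hp⟩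
      omega) (by
      intro D hD
      by_cases hDC : ∃ x ∈ D, x ∈ C
      · obtain ⟨x, hx, hxC⟩ := hDC
        have hsub : D ⊆ C := hD.2.1.subset_of_closed hx hxC
          fun a _ haC b hb hab => hC.2.2 a haC b (hD.1 hb).1 hab
        refine hP.mono hsub (fun y hy => ⟨hsub hy, (hD.1 hy).2⟩) ?_
        rintro u ⟨hu, v, hv, huv⟩
        by_cases huC : u ∈ C
        · right
          by_contra huP
          exact hu (hD.2.2 v hv u ⟨hC.1 huC, huP⟩ huv.symm)
        · exact Or.inl ⟨huC, v, hsub hv, huv⟩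
      · push Not at hDC
        apply hst
        refine ⟨fun y hy => (hD.1 hy).1, hD.2.1, fun a ha b hb hab => ?_⟩
        refine hD.2.2 a ha b ⟨hb, fun hbP => ?_⟩ hab
        exact hDC a ha (hC.2.2 b (hPC hbP) a (hD.1 ha).1 hab.symm))
    refine ⟨fun v => if v ∈ P then 0 else ρ v + 1, fun v hv => ?_⟩
    by_cases hvP : v ∈ P
    · refine le_trans (Set.ncard_le_ncard ?_ (Set.toFinite _)) (hP.ncard_le (hPC hvP))
      rintro u ⟨h1, h2⟩
      have hvC := hPC hvP
      have h2' : u = v ∨ G.Adj u v ∨ ∃ w ∈ C, G.Adj w u ∧ G.Adj w v := by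
        rcases h2 with h | h | ⟨w, hw, _, hwu, hwv⟩
        · exact Or.inl h
        · exact Or.inr (Or.inl h)
        · exact Or.inr (Or.inr ⟨w, hC.2.2 v hvC w hw hwv.symm, hwu, hwv⟩)
      refine ⟨?_, h2'⟩
      rcases h1 with h1 | h1
      · have huC : u ∉ C := fun h => h1 (hC.1 h)
        left
        rcases h2' with rfl | h | ⟨w, hw, hwu, _⟩
        · exact absurd hvC huC
        · exact ⟨huC, v, hvC, h⟩
        · exact ⟨huC, w, hw, hwu.symm⟩
      · right
        by_contra huP
        simp [hvP, huP] at h1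
    · refine le_trans (Set.ncard_le_ncard ?_ (Set.toFinite _)) (hρ v ⟨hv, hvP⟩)
      rintro u ⟨h1, h2⟩
      refine ⟨?_, ?_⟩
      · by_cases huP : u ∈ P
        · exact Or.inl fun h => h.2 huP
        · rcases h1 with h1 | h1
          · exact Or.inl fun h => h1 h.1
          · simp only [hvP, huP, if_false] at h1
            exact Or.inr (by omega)
      · rcases h2 with h | h | ⟨w, hw, hvw, hwu, hwv⟩
        · exact Or.inl h
        · exact Or.inr (Or.inl h)
        · have hwP : w ∉ P := by
            intro hwP
            simp [hvP, hwP] at hvw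
          simp only [hvP, hwP, if_false] at hvw
          exact Or.inr (Or.inr ⟨w, ⟨hw, hwP⟩, by omega, hwu, hwv⟩)

lemma hasState_empty (m : ℕ) (S C : Set V) : HasState G m S C ∅ := by
  refine ⟨fun _ => ∅, ∅, fun _ => ∅, fun _ => ∅, ?_⟩
  constructor <;> simp [Spread]

lemma exists_order_univ [Finite V] {m : ℕ} (hm : 2 ≤ m) (hno : ¬ G.HasCompleteMinor (m + 1)) :
    ∃ ρ : V → ℕ, ∀ v, Set.ncard {u | ρ u ≤ ρ v ∧
      (u = v ∨ G.Adj u v ∨ ∃ w, ρ v ≤ ρ w ∧ G.Adj w u ∧ G.Adj w v)} ≤ 5 * Nat.choose m 2 := by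
  obtain ⟨ρ, hρ⟩ := exists_order hm hno _ Set.univ le_rfl (by
    intro C hC
    have : Nb G C = ∅ := by
      rw [Set.eq_empty_iff_forall_notMem]
      rintro u ⟨hu, v, hv, huv⟩
      exact hu (hC.2.2 v hv u trivial huv.symm)
    rw [this]
    exact hasState_empty m C C)
  exact ⟨ρ, fun v => by simpa using hρ v trivial⟩

end MinorAux

open SignedGraph in
/-- Upper bounds on the signed and sign-preserving chromatic numbers of signed
graphs with no `K_n` minor. -/
theorem chrom_le_of_no_completeMinor {V : Type} [Fintype V]
    (n : ℕ) (hn : 3 ≤ n) (S : SignedGraph V)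
    (hminor : ¬ S.G.HasCompleteMinor n) :
    chromS S ≤ 5 * Nat.choose (n - 1) 2 * 2 ^ (5 * Nat.choose (n - 1) 2 - 2) ∧
      chromSp S ≤ 5 * Nat.choose (n - 1) 2 * 2 ^ (5 * Nat.choose (n - 1) 2 - 1) := by
  obtain ⟨m, rfl⟩ : ∃ m, n = m + 1 := ⟨n - 1, by omega⟩
  have hm : 2 ≤ m := by omega
  obtain ⟨ρ, hρ⟩ := MinorAux.exists_order_univ hm hminor
  rw [Nat.add_sub_cancel]
  have hpos : 0 < Nat.choose m 2 := Nat.choose_pos hm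
  obtain ⟨k, hk⟩ : ∃ k, 5 * Nat.choose m 2 = k + 2 := ⟨5 * Nat.choose m 2 - 2, by omega⟩
  rw [hk] at hρ ⊢
  exact chrom_of_order S k ρ hρ
end

section
/- For every n ≥ 2 there exist a finite simple graph G with no K_n minor and a signature σ of G such that χ_sp((G,σ)) ≥ (2^{n+1} − 5)/3 if n is even, and χ_sp((G,σ)) ≥ (2^{n+1} − 4)/3 if n is odd. -/
open SimpleGraph

namespace SpAux

open SignedGraph

/-- A property that propagates along edges inside a connected set holds everywhere. -/
lemma conn_prop {V : Type} {G : SimpleGraph V} {B : Set V} (hB : (G.induce B).Connected)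
    (p : V → Prop) {x : V} (hx : x ∈ B) (hpx : p x)
    (hstep : ∀ y ∈ B, ∀ z ∈ B, G.Adj y z → p y → p z) : ∀ y ∈ B, p y := by
  intro y hy
  obtain ⟨w⟩ := hB.preconnected ⟨x, hx⟩ ⟨y, hy⟩
  have key : ∀ (a b : B) (w : (G.induce B).Walk a b), p a.1 → p b.1 := by
    intro a b w
    induction w with
    | nil => exact id
    | cons h _ ih =>
      intro ha
      exact ih (hstep _ (Subtype.coe_prop _) _ (Subtype.coe_prop _) h ha)
  exact key _ _ w hpx

/-- Images of connected sets under weak homomorphisms are connected. -/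
lemma conn_map {V V' : Type} {G : SimpleGraph V} {G' : SimpleGraph V'} {B : Set V} {B' : Set V'}
    (hB : (G.induce B).Connected) (r : V → V') (hr : ∀ y ∈ B, r y ∈ B')
    (hadj : ∀ y ∈ B, ∀ z ∈ B, G.Adj y z → r y = r z ∨ G'.Adj (r y) (r z))
    (hsurj : ∀ x ∈ B', ∃ y ∈ B, r y = x) : (G'.induce B').Connected := by
  obtain ⟨⟨b, hb⟩⟩ := hB.nonempty
  have : Nonempty B' := ⟨⟨r b, hr b hb⟩⟩
  refine ⟨?_⟩
  rintro ⟨u, hu⟩ ⟨v, hv⟩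
  obtain ⟨y, hy, rfl⟩ := hsurj u hu
  obtain ⟨z, hz, rfl⟩ := hsurj v hv
  have := conn_prop hB
    (fun t => ∃ h : r t ∈ B', (G'.induce B').Reachable ⟨r y, hu⟩ ⟨r t, h⟩) hy
    ⟨hu, SimpleGraph.Reachable.refl _⟩ (by
      rintro s hs t ht hst ⟨h1, h2⟩
      refine ⟨hr t ht, ?_⟩
      rcases hadj s hs t ht hst with h | h
      · have : (⟨r t, hr t ht⟩ : B') = ⟨r s, h1⟩ := Subtype.ext h.symm
        rw [this]; exact h2
      · have h3 : (G'.induce B').Adj ⟨r s, h1⟩ ⟨r t, hr t ht⟩ := h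
        exact h2.trans h3.reachable) z hz
  exact this.2

/-- Adjacency of the hanging construction. -/
def hangAdj {V W : Type} (S : SimpleGraph V) (G : SimpleGraph W) :
    V ⊕ (V × Bool × W) → V ⊕ (V × Bool × W) → Prop
  | .inl u, .inl v => S.Adj u v
  | .inl u, .inr q => u = q.1
  | .inr q, .inl u => q.1 = u
  | .inr q, .inr q' => q.1 = q'.1 ∧ q.2.1 = q'.2.1 ∧ G.Adj q.2.2 q'.2.2

/-- Signs of the hanging construction. -/
def hangSign {V W : Type} (S : SignedGraph V) (G : SignedGraph W) :
    V ⊕ (V × Bool × W) → V ⊕ (V × Bool × W) → Bool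
  | .inl u, .inl v => S.sign u v
  | .inl _, .inr q => q.2.1
  | .inr q, .inl _ => q.2.1
  | .inr q, .inr q' => G.sign q.2.2 q'.2.2

/-- At every vertex of `S` hang a positive and a negative cone over `G`. -/
def hang {V W : Type} (S : SignedGraph V) (G : SignedGraph W) :
    SignedGraph (V ⊕ (V × Bool × W)) where
  G := { Adj := hangAdj S.G G.G
         symm := ⟨by
          rintro (u | ⟨u, b, w⟩) (v | ⟨v, c, x⟩) h
          · exact SimpleGraph.Adj.symm h
          · exact Eq.symm h
          · exact Eq.symm h
          · exact ⟨h.1.symm, h.2.1.symm, h.2.2.symm⟩⟩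
         loopless := ⟨by
          rintro (u | ⟨u, b, w⟩) h
          · exact S.G.loopless.irrefl u h
          · exact G.G.loopless.irrefl w h.2.2⟩ }
  sign := hangSign S G
  sign_symm := by
    rintro (u | ⟨u, b, w⟩) (v | ⟨v, c, x⟩)
    · exact S.sign_symm _ _
    · rfl
    · rfl
    · exact G.sign_symm _ _

/-- Root of a vertex. -/
def root {V W : Type} : V ⊕ (V × Bool × W) → V
  | .inl u => u
  | .inr q => q.1

lemma hang_minor {V W : Type} (S : SignedGraph V) (G : SignedGraph W) (n : ℕ)
    (hS : ¬ S.G.HasCompleteMinor (n + 1)) (hG : ¬ G.G.HasCompleteMinor n) :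
    ¬ (hang S G).G.HasCompleteMinor (n + 1) := by
  rintro ⟨B, hne, hconn, hdisj, hadj⟩
  by_cases hA : ∀ i, ∃ u : V, Sum.inl u ∈ B i
  · apply hS
    have hroot : ∀ i, ∀ y ∈ B i, Sum.inl (root y) ∈ B i := by
      intro i
      obtain ⟨u, hu⟩ := hA i
      refine conn_prop (hconn i) (fun y => Sum.inl (root y) ∈ B i) hu hu ?_
      rintro (y | ⟨y, b, w⟩) hy (z | ⟨z, c, x⟩) hz h hp
      · exact hz
      · have h' : y = z := h
        subst h'; exact hy
      · exact hz
      · have h' : y = z := h.1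
        subst h'; exact hp
    refine ⟨fun i => {u | Sum.inl u ∈ B i}, hA, ?_, ?_, ?_⟩
    · intro i
      refine conn_map (hconn i) root (hroot i) ?_ (fun x hx => ⟨Sum.inl x, hx, rfl⟩)
      rintro (y | ⟨y, b, w⟩) hy (z | ⟨z, c, x⟩) hz h
      · exact Or.inr h
      · exact Or.inl h
      · exact Or.inl h
      · exact Or.inl h.1
    · intro i j hij
      rw [Set.disjoint_left]
      intro u hu hu'
      exact Set.disjoint_left.1 (hdisj i j hij) hu hu'
    · intro i j hij
      obtain ⟨y, hy, z, hz, h⟩ := hadj i j hij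
      have hy' := hroot i y hy
      have hz' := hroot j z hz
      refine ⟨root y, hy', root z, hz', ?_⟩
      have hne' : root y ≠ root z := fun e =>
        Set.disjoint_left.1 (hdisj i j hij) hy' (by rw [e]; exact hz')
      rcases y with (y | ⟨y, b, w⟩) <;> rcases z with (z | ⟨z, c, x⟩)
      · exact h
      · exact absurd h hne'
      · exact absurd h hne'
      · exact absurd h.1 hne'
  · push Not at hA
    obtain ⟨i0, hi0⟩ := hA
    apply hG
    obtain ⟨y0, hy0⟩ := hne i0
    rcases y0 with (u | ⟨v, b, w0⟩)
    · exact absurd hy0 (hi0 u)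
    have hin : ∀ j, Sum.inl v ∉ B j → (∃ w, Sum.inr (v, b, w) ∈ B j) →
        ∀ y ∈ B j, ∃ w, y = Sum.inr (v, b, w) := by
      rintro j hv ⟨w, hw⟩
      refine conn_prop (hconn j) (fun y => ∃ w, y = Sum.inr (v, b, w)) hw ⟨w, rfl⟩ ?_
      rintro _ hy (z | ⟨z, c, x⟩) hz h ⟨w', rfl⟩
      · have h' : v = z := h
        subst h'; exact absurd hz hv
      · obtain ⟨h1, h2, -⟩ := h
        change v = z at h1
        change b = c at h2
        subst h1; subst h2
        exact ⟨x, rfl⟩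
    have hi0C := hin i0 (hi0 v) ⟨w0, hy0⟩
    obtain ⟨i1, hi1⟩ : ∃ i1, ∀ j, j ≠ i1 → Sum.inl v ∉ B j := by
      by_cases h : ∃ i1, Sum.inl v ∈ B i1
      · obtain ⟨i1, h1⟩ := h
        exact ⟨i1, fun j hj hv => Set.disjoint_left.1 (hdisj j i1 hj) hv h1⟩
      · push Not at h
        exact ⟨i0, fun j _ => h j⟩
    have hC : ∀ j, j ≠ i1 → ∀ y ∈ B j, ∃ w, y = Sum.inr (v, b, w) := by
      intro j hj
      by_cases hj0 : j = i0
      · rw [hj0]; exact hi0C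
      · apply hin j (hi1 j hj)
        obtain ⟨y, hy, z, hz, h⟩ := hadj i0 j (Ne.symm hj0)
        obtain ⟨w, rfl⟩ := hi0C y hy
        rcases z with (z | ⟨z, c, x⟩)
        · have h' : v = z := h
          subst h'; exact absurd hz (hi1 j hj)
        · obtain ⟨h1, h2, -⟩ := h
          change v = z at h1
          change b = c at h2
          subst h1; subst h2
          exact ⟨x, hz⟩
    refine ⟨fun j => {w | Sum.inr (v, b, w) ∈ B (i1.succAbove j)}, ?_, ?_, ?_, ?_⟩
    · intro j
      obtain ⟨y, hy⟩ := hne (i1.succAbove j)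
      obtain ⟨w, rfl⟩ := hC _ (Fin.succAbove_ne i1 j) y hy
      exact ⟨w, hy⟩
    · intro j
      have hCj := hC _ (Fin.succAbove_ne i1 j)
      refine conn_map (hconn (i1.succAbove j))
        (fun y => Sum.elim (fun _ => w0) (fun q => q.2.2) y) ?_ ?_
        (fun x hx => ⟨Sum.inr (v, b, x), hx, rfl⟩)
      · intro y hy
        obtain ⟨w, rfl⟩ := hCj y hy
        exact hy
      · intro y hy z hz h
        obtain ⟨w, rfl⟩ := hCj y hy
        obtain ⟨x, rfl⟩ := hCj z hz
        exact Or.inr h.2.2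
    · intro i j hij
      rw [Set.disjoint_left]
      intro w hw hw'
      exact Set.disjoint_left.1
        (hdisj _ _ (fun e => hij (Fin.succAbove_right_injective e))) hw hw'
    · intro i j hij
      obtain ⟨y, hy, z, hz, h⟩ := hadj (i1.succAbove i) (i1.succAbove j)
        (fun e => hij (Fin.succAbove_right_injective e))
      obtain ⟨w, rfl⟩ := hC _ (Fin.succAbove_ne i1 i) y hy
      obtain ⟨x, rfl⟩ := hC _ (Fin.succAbove_ne i1 j) z hz
      exact ⟨w, hy, x, hz, h.2.2⟩

/-- Every image of `S` has at least `a` vertices. -/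
def LB {V : Type} (S : SignedGraph V) (a : ℕ) : Prop :=
  ∀ (N : ℕ) (T : SignedGraph (Fin N)) (f : V → Fin N) (F : Finset (Fin N)),
    IsSpHom S T f → (∀ x, f x ∈ F) → a ≤ F.card

open Classical in
/-- Neighbours of `u` of sign `b` inside `U`. -/
noncomputable def nb {N : ℕ} (T : SignedGraph (Fin N)) (U : Finset (Fin N)) (b : Bool)
    (u : Fin N) : Finset (Fin N) :=
  U.filter (fun x => T.G.Adj u x ∧ T.sign u x = b)

/-- `U` is closed: all signed degrees inside `U` are at least `a`. -/
def Closed {N : ℕ} (T : SignedGraph (Fin N)) (a : ℕ) (U : Finset (Fin N)) : Prop :=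
  U.Nonempty ∧ ∀ u ∈ U, ∀ b, a ≤ (nb T U b u).card

/-- The next lower bound. -/
def nxt (a : ℕ) : ℕ := if Even a then 2 * a + 1 else 2 * a + 2

lemma nb_sum_le {N : ℕ} (T : SignedGraph (Fin N)) (U : Finset (Fin N)) (u : Fin N) (hu : u ∈ U) :
    (nb T U true u).card + (nb T U false u).card + 1 ≤ U.card := by
  classical
  have hd : Disjoint (nb T U true u) (nb T U false u) := by
    rw [Finset.disjoint_left]
    intro x hx hx'
    simp only [nb, Finset.mem_filter] at hx hx'
    rw [hx.2.2] at hx'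
    simp at hx'
  rw [← Finset.card_union_of_disjoint hd]
  have hnu : u ∉ nb T U true u ∪ nb T U false u := by
    simp [nb]
  rw [← Finset.card_insert_of_notMem hnu]
  apply Finset.card_le_card
  intro x hx
  simp only [nb, Finset.mem_insert, Finset.mem_union, Finset.mem_filter] at hx
  rcases hx with rfl | h | h
  · exact hu
  · exact h.1
  · exact h.1

lemma Closed.card_le {N : ℕ} {T : SignedGraph (Fin N)} {a : ℕ} {U : Finset (Fin N)}
    (h : Closed T a U) : nxt a ≤ U.card := by
  classical
  obtain ⟨⟨u, hu⟩, hU⟩ := h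
  have h0 := nb_sum_le T U u hu
  have h1 := hU u hu true
  have h2 := hU u hu false
  unfold nxt
  split_ifs with ha
  · omega
  · by_contra hlt
    have hcard : U.card = 2 * a + 1 := by omega
    let P : SimpleGraph (Fin N) :=
      { Adj := fun x y => x ∈ U ∧ y ∈ U ∧ T.G.Adj x y ∧ T.sign x y = true
        symm := ⟨fun x y h => ⟨h.2.1, h.1, h.2.2.1.symm, by rw [T.sign_symm]; exact h.2.2.2⟩⟩
        loopless := ⟨fun x h => T.G.loopless.irrefl x h.2.2.1⟩ }
    have hdeg : ∀ x, P.degree x = if x ∈ U then a else 0 := by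
      intro x
      rw [← SimpleGraph.card_neighborFinset_eq_degree]
      split_ifs with hx
      · have e : P.neighborFinset x = nb T U true x := by
          ext y
          simp only [SimpleGraph.mem_neighborFinset, nb, Finset.mem_filter]
          exact ⟨fun h => ⟨h.2.1, h.2.2⟩, fun h => ⟨hx, h.1, h.2⟩⟩
        rw [e]
        have := nb_sum_le T U x hx
        have := hU x hx true
        have := hU x hx false
        omega
      · rw [Finset.card_eq_zero, Finset.eq_empty_iff_forall_notMem]
        intro y hy
        rw [SimpleGraph.mem_neighborFinset] at hy
        exact hx hy.1
    have hev := P.even_card_odd_degree_vertices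
    have e : (Finset.univ.filter fun v => Odd (P.degree v)) = U := by
      ext x
      simp only [Finset.mem_filter, Finset.mem_univ, true_and, hdeg]
      split_ifs with hx
      · simp [hx, Nat.not_even_iff_odd.1 ha]
      · simp [hx]
    rw [e, hcard] at hev
    exact absurd hev (by simp)

/-- The property of being a finite graph with the tower property at height `k`. -/
lemma tower {W : Type} [Fintype W] (G : SignedGraph W) (n a : ℕ) (hn : 1 ≤ n)
    (hG : ¬ G.G.HasCompleteMinor n) (hLB : LB G a) (k : ℕ) :
    ∃ (V : Type) (_ : Fintype V) (S : SignedGraph V), ¬ S.G.HasCompleteMinor (n + 1) ∧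
      ∀ (N : ℕ) (T : SignedGraph (Fin N)) (f : V → Fin N), IsSpHom S T f →
        k + 1 ≤ (Finset.univ.image f).card ∨ ∃ U ⊆ Finset.univ.image f, Closed T a U := by
  induction k with
  | zero =>
    refine ⟨Unit, inferInstance, ⟨⊥, fun _ _ => true, fun _ _ => rfl⟩, ?_, ?_⟩
    · rintro ⟨B, -, -, -, hadj⟩
      obtain ⟨u, -, v, -, h⟩ := hadj ⟨0, by omega⟩ ⟨1, by omega⟩ (by simp)
      exact h
    · intro N T f _
      left
      simp
  | succ k ih =>
    obtain ⟨V, hV, S, hS, hT⟩ := ih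
    refine ⟨V ⊕ (V × Bool × W), inferInstance, hang S G, hang_minor S G n hS hG, ?_⟩
    intro N T f hf
    have hsub : Finset.univ.image (f ∘ Sum.inl) ⊆ Finset.univ.image f := by
      intro x hx
      simp only [Finset.mem_image, Finset.mem_univ, true_and, Function.comp] at hx ⊢
      obtain ⟨y, hy⟩ := hx
      exact ⟨_, hy⟩
    rcases hT N T (f ∘ Sum.inl) (fun u v h => hf (Sum.inl u) (Sum.inl v) h) with h | ⟨U, hU, hc⟩
    · by_cases heq : Finset.univ.image (f ∘ Sum.inl) = Finset.univ.image f
      · right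
        refine ⟨_, subset_rfl, ?_, ?_⟩
        · rw [← heq, ← Finset.card_pos]; omega
        · intro u hu b
          rw [← heq] at hu
          simp only [Finset.mem_image, Finset.mem_univ, true_and, Function.comp] at hu
          obtain ⟨v, rfl⟩ := hu
          refine hLB N T (fun w => f (Sum.inr (v, b, w))) _ ?_ ?_
          · intro w x hwx
            exact hf (Sum.inr (v, b, w)) (Sum.inr (v, b, x)) ⟨rfl, rfl, hwx⟩
          · intro w
            simp only [nb, Finset.mem_filter]
            exact ⟨Finset.mem_image_of_mem _ (Finset.mem_univ _),
              hf (Sum.inl v) (Sum.inr (v, b, w)) rfl⟩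
      · left
        have := Finset.card_lt_card (Finset.ssubset_iff_subset_ne.2 ⟨hsub, heq⟩)
        omega
    · exact Or.inr ⟨U, hU.trans hsub, hc⟩

/-- The sequence of lower bounds. -/
def bnd : ℕ → ℕ
  | 0 => 0
  | k + 1 => nxt (bnd k)

lemma main_aux (k : ℕ) : ∃ (V : Type) (_ : Fintype V) (S : SignedGraph V),
    ¬ S.G.HasCompleteMinor (k + 1) ∧ LB S (bnd k) := by
  induction k with
  | zero =>
    refine ⟨Empty, inferInstance, ⟨⊥, fun _ _ => true, fun _ _ => rfl⟩, ?_, ?_⟩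
    · rintro ⟨B, hne, -⟩
      obtain ⟨x, -⟩ := hne 0
      exact x.elim
    · intro N T f F _ _
      exact Nat.zero_le _
  | succ k ih =>
    obtain ⟨W, hW, G, hG, hLB⟩ := ih
    obtain ⟨V, hV, S, hS, hT⟩ := tower G (k + 1) (bnd k) (by omega) hG hLB (nxt (bnd k))
    refine ⟨V, hV, S, hS, ?_⟩
    intro N T f F hf hF
    have hsub : Finset.univ.image f ⊆ F := by
      intro x hx
      simp only [Finset.mem_image, Finset.mem_univ, true_and] at hx
      obtain ⟨y, rfl⟩ := hx
      exact hF y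
    change nxt (bnd k) ≤ _
    rcases hT N T f hf with h | ⟨U, hU, hc⟩
    · have := Finset.card_le_card hsub
      omega
    · exact hc.card_le.trans (Finset.card_le_card (hU.trans hsub))

lemma bnd_formula (k : ℕ) :
    (Even k → 3 * bnd k + 4 = 2 ^ (k + 2) ∧ Even (bnd k)) ∧
    (¬ Even k → 3 * bnd k + 5 = 2 ^ (k + 2) ∧ ¬ Even (bnd k)) := by
  induction k with
  | zero => simp [bnd]
  | succ k ih =>
    have hb : bnd (k + 1) = nxt (bnd k) := rfl
    have hp : 2 ^ (k + 1 + 2) = 2 * 2 ^ (k + 2) := by ring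
    by_cases hk : Even k
    · obtain ⟨h1, h2⟩ := ih.1 hk
      have hk' : ¬ Even (k + 1) := by simpa [Nat.even_add_one] using hk
      refine ⟨fun h => absurd h hk', fun _ => ?_⟩
      rw [hb, nxt, if_pos h2, hp]
      exact ⟨by omega, by simp⟩
    · obtain ⟨h1, h2⟩ := ih.2 hk
      have hk' : Even (k + 1) := by simpa [Nat.even_add_one] using hk
      refine ⟨fun _ => ?_, fun h => absurd hk' h⟩
      rw [hb, nxt, if_neg h2, hp]
      exact ⟨by omega, ⟨bnd k + 1, by ring⟩⟩

end SpAux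

open SignedGraph in
/-- For every `n ≥ 2` there is a signed graph with no `K_n` minor and large
sign-preserving chromatic number. -/
theorem exists_no_completeMinor_chromSp_large (n : ℕ) (hn : 2 ≤ n) :
    ∃ (m : ℕ) (S : SignedGraph (Fin m)), ¬ S.G.HasCompleteMinor n ∧
      (Even n → (2 ^ (n + 1) - 5) / 3 ≤ chromSp S) ∧
      (Odd n → (2 ^ (n + 1) - 4) / 3 ≤ chromSp S) := by
  obtain ⟨k, rfl⟩ : ∃ k, n = k + 1 := ⟨n - 1, by omega⟩
  obtain ⟨V, hV, S, hS, hLB⟩ := SpAux.main_aux k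
  let e := Fintype.equivFin V
  let S' : SignedGraph (Fin (Fintype.card V)) :=
    { G := S.G.comap e.symm
      sign := fun x y => S.sign (e.symm x) (e.symm y)
      sign_symm := fun x y => S.sign_symm _ _ }
  have hchrom : SpAux.bnd k ≤ chromSp S' := by
    have hmem : chromSp S' ∈
        {n : ℕ | ∃ T : SignedGraph (Fin n), ∃ f : Fin (Fintype.card V) → Fin n, IsSpHom S' T f} :=
      Nat.sInf_mem ⟨_, S', id, fun u v h => ⟨h, rfl⟩⟩
    obtain ⟨T, f, hf⟩ := hmem
    have := hLB _ T (f ∘ e) Finset.univ (by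
      intro u v h
      have := hf (e u) (e v) (by simpa [S'] using h)
      simpa [S'] using this) (fun _ => Finset.mem_univ _)
    simpa using this
  refine ⟨_, S', ?_, ?_, ?_⟩
  · rintro ⟨B, hne, hconn, hdisj, hadj⟩
    apply hS
    refine ⟨fun i => {v | e v ∈ B i}, ?_, ?_, ?_, ?_⟩
    · intro i
      obtain ⟨x, hx⟩ := hne i
      exact ⟨e.symm x, by simpa using hx⟩
    · intro i
      refine SpAux.conn_map (hconn i) e.symm ?_ ?_ ?_
      · intro y hy
        simpa using hy
      · intro y _ z _ h
        exact Or.inr h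
      · intro x hx
        exact ⟨e x, hx, by simp⟩
    · intro i j hij
      rw [Set.disjoint_left]
      intro v hv hv'
      exact Set.disjoint_left.1 (hdisj i j hij) hv hv'
    · intro i j hij
      obtain ⟨y, hy, z, hz, h⟩ := hadj i j hij
      exact ⟨e.symm y, by simpa using hy, e.symm z, by simpa using hz, h⟩
  · intro h
    have hk : ¬ Even k := by simpa [Nat.even_add_one] using h
    have := ((SpAux.bnd_formula k).2 hk).1
    rw [show k + 1 + 1 = k + 2 from rfl]
    omega
  · intro h
    have hk : Even k := by
      rw [← Nat.not_even_iff_odd, Nat.even_add_one] at h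
      exact not_not.1 h
    have := ((SpAux.bnd_formula k).1 hk).1
    rw [show k + 1 + 1 = k + 2 from rfl]
    omega
end

section
/- For every n ≥ 2 there exist a finite simple graph G with no K_n minor and a signature σ of G such that χ_s((G,σ)) ≥ (2^{n} − 1)/3 if n is even, and χ_s((G,σ)) ≥ (2^{n} − 2)/3 if n is odd. -/
open SimpleGraph

open SignedGraph

/-- Set-theoretic form of connectedness of an induced subgraph. -/
def SConn {V : Type} (G : SimpleGraph V) (B : Set V) : Prop :=
  ∀ A : Set V, (∃ x ∈ B, x ∈ A) → (∀ x ∈ B, x ∈ A → ∀ y ∈ B, G.Adj x y → y ∈ A) → B ⊆ A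

/-- A family of branch sets. -/
def IsMinorModel {V : Type} (G : SimpleGraph V) (n : ℕ) (B : Fin n → Set V) : Prop :=
  (∀ i, (B i).Nonempty) ∧ (∀ i, SConn G (B i)) ∧
    (∀ i j, i ≠ j → ∀ x, x ∈ B i → x ∈ B j → False) ∧
    (∀ i j, i ≠ j → ∃ u ∈ B i, ∃ v ∈ B j, G.Adj u v)

lemma sconn_of_preconnected {V : Type} (G : SimpleGraph V) (B : Set V)
    (h : (G.induce B).Preconnected) : SConn G B := by
  rintro A ⟨x, hxB, hxA⟩ hcl y hyB
  obtain ⟨w⟩ := h ⟨x, hxB⟩ ⟨y, hyB⟩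
  have key : ∀ (a b : B) (w : (G.induce B).Walk a b), a.1 ∈ A → b.1 ∈ A := by
    intro a b w
    induction w with
    | nil => exact id
    | cons hadj _ ih =>
      intro ha
      exact ih (hcl _ (Subtype.property _) ha _ (Subtype.property _) hadj)
  exact key _ _ w hxA

lemma preconnected_of_sconn {V : Type} (G : SimpleGraph V) (B : Set V)
    (h : SConn G B) : (G.induce B).Preconnected := by
  rintro ⟨x, hx⟩ ⟨y, hy⟩
  have := h {z | ∃ hz : z ∈ B, (G.induce B).Reachable ⟨x, hx⟩ ⟨z, hz⟩}
    ⟨x, hx, hx, SimpleGraph.Reachable.refl _⟩ (by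
      rintro a ha ⟨_, hr⟩ b hb hab
      refine ⟨hb, hr.trans (SimpleGraph.Adj.reachable ?_)⟩
      exact hab) hy
  exact this.2

lemma hasCompleteMinor_iff {V : Type} (G : SimpleGraph V) (n : ℕ) :
    G.HasCompleteMinor n ↔ ∃ B, IsMinorModel G n B := by
  constructor
  · rintro ⟨B, h1, h2, h3, h4⟩
    exact ⟨B, h1, fun i => sconn_of_preconnected G _ (h2 i).preconnected,
      fun i j hij x hx hy => Set.disjoint_left.1 (h3 i j hij) hx hy, h4⟩
  · rintro ⟨B, h1, h2, h3, h4⟩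
    refine ⟨B, h1, fun i => ?_, fun i j hij => Set.disjoint_left.2 (fun x => h3 i j hij x), h4⟩
    have : Nonempty (B i) := (h1 i).to_subtype
    exact ⟨preconnected_of_sconn G _ (h2 i)⟩

lemma minor_pull {V W : Type} {G : SimpleGraph V} {H : SimpleGraph W} {n : ℕ} (f : V → W)
    (hinj : Function.Injective f) (hf : ∀ a b, H.Adj (f a) (f b) → G.Adj a b)
    (B : Fin n → Set W) (hB : IsMinorModel H n B) (hr : ∀ i, B i ⊆ Set.range f) :
    G.HasCompleteMinor n := by
  rw [hasCompleteMinor_iff]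
  obtain ⟨h1, h2, h3, h4⟩ := hB
  refine ⟨fun i => f ⁻¹' B i, ?_, ?_, ?_, ?_⟩
  · intro i
    obtain ⟨y, hy⟩ := h1 i
    obtain ⟨x, rfl⟩ := hr i hy
    exact ⟨x, hy⟩
  · rintro i A ⟨x, hx, hxA⟩ hcl b hb
    have := h2 i (f '' A) ⟨f x, hx, x, hxA, rfl⟩ (by
      rintro _ ha ⟨a, haA, rfl⟩ y hy hay
      obtain ⟨c, rfl⟩ := hr i hy
      exact ⟨c, hcl a ha haA c hy (hf _ _ hay), rfl⟩) hb
    obtain ⟨a, ha, hab⟩ := this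
    exact hinj hab ▸ ha
  · intro i j hij x
    exact h3 i j hij (f x)
  · intro i j hij
    obtain ⟨u, hu, v, hv, huv⟩ := h4 i j hij
    obtain ⟨a, rfl⟩ := hr i hu
    obtain ⟨b, rfl⟩ := hr j hv
    exact ⟨a, hu, b, hv, hf _ _ huv⟩

/-- Disjoint union of signed graphs. -/
def sumSG {V W : Type} (S : SignedGraph V) (H : SignedGraph W) : SignedGraph (V ⊕ W) where
  G := S.G ⊕g H.G
  sign := fun p q => match p, q with
    | .inl a, .inl b => S.sign a b
    | .inr a, .inr b => H.sign a b
    | _, _ => true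
  sign_symm := by
    rintro (a | a) (b | b)
    · exact S.sign_symm a b
    · rfl
    · rfl
    · exact H.sign_symm a b

lemma sum_minor {V W : Type} (S : SignedGraph V) (H : SignedGraph W) {n : ℕ} (hn : 1 ≤ n)
    (hS : ¬ S.G.HasCompleteMinor n) (hH : ¬ H.G.HasCompleteMinor n) :
    ¬ (sumSG S H).G.HasCompleteMinor n := by
  intro h
  obtain ⟨B, hB⟩ := (hasCompleteMinor_iff _ _).1 h
  obtain ⟨h1, h2, h3, h4⟩ := id hB
  have hl : ∀ i, (∃ a, Sum.inl a ∈ B i) → B i ⊆ Set.range Sum.inl := by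
    rintro i ⟨a, ha⟩
    refine h2 i _ ⟨_, ha, a, rfl⟩ ?_
    rintro _ _ ⟨c, rfl⟩ (y | y) _ hadj
    · exact ⟨y, rfl⟩
    · simp [sumSG] at hadj
  have hr : ∀ i, (∃ a, Sum.inr a ∈ B i) → B i ⊆ Set.range Sum.inr := by
    rintro i ⟨a, ha⟩
    refine h2 i _ ⟨_, ha, a, rfl⟩ ?_
    rintro _ _ ⟨c, rfl⟩ (y | y) _ hadj
    · simp [sumSG] at hadj
    · exact ⟨y, rfl⟩
  let i0 : Fin n := ⟨0, hn⟩
  obtain ⟨p | p, hp⟩ := h1 i0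
  · apply hS
    have h0 := hl i0 ⟨p, hp⟩
    refine minor_pull Sum.inl Sum.inl_injective (fun a b hab => by simpa [sumSG] using hab) B hB ?_
    intro j
    by_cases hj : i0 = j
    · exact hj ▸ h0
    · obtain ⟨u, hu, v, hv, huv⟩ := h4 i0 j hj
      obtain ⟨c, rfl⟩ := h0 hu
      rcases v with v | v
      · exact hl j ⟨v, hv⟩
      · simp [sumSG] at huv
  · apply hH
    have h0 := hr i0 ⟨p, hp⟩
    refine minor_pull Sum.inr Sum.inr_injective (fun a b hab => by simpa [sumSG] using hab) B hB ?_
    intro j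
    by_cases hj : i0 = j
    · exact hj ▸ h0
    · obtain ⟨u, hu, v, hv, huv⟩ := h4 i0 j hj
      obtain ⟨c, rfl⟩ := h0 hu
      rcases v with v | v
      · simp [sumSG] at huv
      · exact hr j ⟨v, hv⟩

/-- Attach to every vertex `v` of `S` a private copy of `H`, completely joined to `v`
by edges of sign `s`. -/
def starSG {V W : Type} (S : SignedGraph V) (H : SignedGraph W) (s : Bool) :
    SignedGraph (V × Option W) where
  G :=
    { Adj := fun p q => match p, q with
        | (v, none), (v', none) => S.G.Adj v v'
        | (v, none), (v', some _) => v = v'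
        | (v, some _), (v', none) => v = v'
        | (v, some w), (v', some w') => v = v' ∧ H.G.Adj w w'
      symm := ⟨by
        rintro ⟨v, _ | w⟩ ⟨v', _ | w'⟩ h
        · exact S.G.symm.symm _ _ h
        · exact Eq.symm h
        · exact Eq.symm h
        · exact ⟨h.1.symm, H.G.symm.symm _ _ h.2⟩⟩
      loopless := ⟨by
        rintro ⟨v, _ | w⟩ h
        · exact S.G.loopless.irrefl _ h
        · exact H.G.loopless.irrefl _ h.2⟩ }
  sign := fun p q => match p, q with
    | (v, none), (v', none) => S.sign v v'
    | (_, some w), (_, some w') => H.sign w w'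
    | _, _ => s
  sign_symm := by
    rintro ⟨v, _ | w⟩ ⟨v', _ | w'⟩
    · exact S.sign_symm _ _
    · rfl
    · rfl
    · exact H.sign_symm _ _

lemma star_minor {V W : Type} (S : SignedGraph V) (H : SignedGraph W) (s : Bool) {n : ℕ}
    (hS : ¬ S.G.HasCompleteMinor (n + 1)) (hH : ¬ H.G.HasCompleteMinor n) :
    ¬ (starSG S H s).G.HasCompleteMinor (n + 1) := by
  intro h
  obtain ⟨B, hB⟩ := (hasCompleteMinor_iff _ _).1 h
  obtain ⟨h1, h2, h3, h4⟩ := id hB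
  have F : ∀ i v, (v, none) ∉ B i → (∃ w, (v, some w) ∈ B i) →
      B i ⊆ Set.range (fun w : W => (v, some w)) := by
    rintro i v hv ⟨w, hw⟩
    refine h2 i _ ⟨_, hw, w, rfl⟩ ?_
    rintro _ _ ⟨c, rfl⟩ ⟨v', _ | w'⟩ hy hadj
    · have : v = v' := hadj
      subst this
      exact absurd hy hv
    · have : v = v' := hadj.1
      subst this
      exact ⟨w', rfl⟩
  by_cases hbase : ∀ i, ∃ v, (v, none) ∈ B i
  · apply hS
    rw [hasCompleteMinor_iff]
    have hmem : ∀ i p, p ∈ B i → (p.1, none) ∈ B i := by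
      rintro i ⟨v, _ | w⟩ hp
      · exact hp
      · by_contra hc
        obtain ⟨v', hv'⟩ := hbase i
        obtain ⟨c, hc⟩ := F i v hc ⟨w, hp⟩ hv'
        simp at hc
    have hdis : ∀ i j, i ≠ j → ∀ x, x ∈ Prod.fst '' B i → x ∈ Prod.fst '' B j → False := by
      rintro i j hij _ ⟨p, hp, rfl⟩ ⟨q, hq, hqp⟩
      have := hmem j q hq
      rw [hqp] at this
      exact h3 i j hij _ (hmem i p hp) this
    have hadj' : ∀ p q, (starSG S H s).G.Adj p q → p.1 = q.1 ∨ S.G.Adj p.1 q.1 := by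
      rintro ⟨v, _ | w⟩ ⟨v', _ | w'⟩ hpq
      · exact Or.inr hpq
      · exact Or.inl hpq
      · exact Or.inl hpq
      · exact Or.inl hpq.1
    refine ⟨fun i => Prod.fst '' B i, fun i => (h1 i).image _, ?_, hdis, ?_⟩
    · rintro i A ⟨_, ⟨p, hp, rfl⟩, hpA⟩ hcl _ ⟨q, hq, rfl⟩
      refine h2 i (Prod.fst ⁻¹' A) ⟨p, hp, hpA⟩ ?_ hq
      intro a ha haA b hb hab
      rcases hadj' _ _ hab with h | h
      · show b.1 ∈ A
        exact h ▸ haA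
      · exact hcl _ ⟨a, ha, rfl⟩ haA _ ⟨b, hb, rfl⟩ h
    · intro i j hij
      obtain ⟨u, hu, v, hv, huv⟩ := h4 i j hij
      refine ⟨u.1, ⟨u, hu, rfl⟩, v.1, ⟨v, hv, rfl⟩, ?_⟩
      rcases hadj' _ _ huv with h | h
      · exact (hdis i j hij u.1 ⟨u, hu, rfl⟩ ⟨v, hv, h.symm⟩).elim
      · exact h
  · push Not at hbase
    obtain ⟨i, hi⟩ := hbase
    obtain ⟨⟨v, _ | w⟩, hp⟩ := h1 i
    · exact hi v hp
    have hir := F i v (hi v) ⟨w, hp⟩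
    have hall : ∀ j, (v, none) ∉ B j → B j ⊆ Set.range (fun w : W => (v, some w)) := by
      intro j hj
      by_cases hij : i = j
      · exact hij ▸ hir
      · obtain ⟨u, hu, ⟨v', _ | w'⟩, hv, huv⟩ := h4 i j hij
        · obtain ⟨c, rfl⟩ := hir hu
          have : v = v' := huv
          subst this
          exact absurd hv hj
        · obtain ⟨c, rfl⟩ := hir hu
          have : v = v' := huv.1
          subst this
          exact F j v hj ⟨w', hv⟩
    obtain ⟨d, hd⟩ : ∃ d, ∀ k, k ≠ d → (v, none) ∉ B k := by
      by_cases hex : ∃ j, (v, none) ∈ B j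
      · obtain ⟨j, hj⟩ := hex
        exact ⟨j, fun k hk hkv => h3 k j hk _ hkv hj⟩
      · exact ⟨i, fun k _ hk => hex ⟨k, hk⟩⟩
    apply hH
    refine minor_pull (fun w : W => (v, some w)) (fun a b hab => by simpa using hab)
      (H := (starSG S H s).G) (fun a b hab => hab.2) (fun k => B (d.succAbove k)) ?_ ?_
    · exact ⟨fun k => h1 _, fun k => h2 _,
        fun k l hkl => h3 _ _ (fun e => hkl (Fin.succAbove_right_injective e)),
        fun k l hkl => h4 _ _ (fun e => hkl (Fin.succAbove_right_injective e))⟩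
    · intro k
      exact hall _ (hd _ (Fin.succAbove_ne d k))

/-- The one-vertex signed graph. -/
def oneSG : SignedGraph Unit := ⟨⊥, fun _ _ => true, fun _ _ => rfl⟩

lemma one_minor (n : ℕ) : ¬ oneSG.G.HasCompleteMinor (n + 2) := by
  rintro ⟨B, _, _, _, h4⟩
  obtain ⟨u, _, v, _, h⟩ := h4 0 1 (by simp)
  exact h

/-- Edge-preserving maps that preserve signs of triangles. -/
def IsTri {V W : Type} (S : SignedGraph V) (T : SignedGraph W) (f : V → W) : Prop :=
  (∀ u v, S.G.Adj u v → T.G.Adj (f u) (f v)) ∧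
  ∀ a b c, S.G.Adj a b → S.G.Adj b c → S.G.Adj c a →
    (T.sign (f a) (f b) == (T.sign (f b) (f c) == T.sign (f c) (f a))) =
      (S.sign a b == (S.sign b c == S.sign c a))

lemma IsHom.isTri {V W : Type} {S : SignedGraph V} {T : SignedGraph W} {f : V → W}
    (h : SignedGraph.IsHom S T f) : IsTri S T f := by
  obtain ⟨hadj, hw⟩ := h
  refine ⟨hadj, fun a b c hab hbc hca => ?_⟩
  have := hw a (.cons hab (.cons hbc (.cons hca .nil)))
  simpa [SignedGraph.walkSign] using this

/-- The bounds. -/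
def bb : ℕ → ℕ
  | 0 => 0
  | k + 1 => if Even (bb k) then 2 * bb k + 1 else 2 * bb k + 2

lemma bb_spec (k : ℕ) : (Even k → Even (bb k) ∧ 3 * bb k + 4 = 2 ^ (k + 2)) ∧
    (Odd k → Odd (bb k) ∧ 3 * bb k + 5 = 2 ^ (k + 2)) := by
  induction k with
  | zero => simp [bb]
  | succ k ih =>
    constructor
    · intro h
      have hk : Odd k := by
        rcases Nat.even_or_odd k with h' | h'
        · exact absurd h (by simpa [Nat.even_add_one] using h')
        · exact h'
      obtain ⟨h1, h2⟩ := ih.2 hk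
      have : ¬ Even (bb k) := by simpa using h1
      simp only [bb, if_neg this]
      refine ⟨⟨bb k + 1, by ring⟩, ?_⟩
      rw [show k + 1 + 2 = (k + 2) + 1 by ring, pow_succ, ← h2]; ring
    · intro h
      have hk : Even k := by
        rcases Nat.even_or_odd k with h' | h'
        · exact h'
        · exact absurd h (by simpa [Nat.odd_add_one] using h')
      obtain ⟨h1, h2⟩ := ih.1 hk
      simp only [bb, if_pos h1]
      refine ⟨⟨bb k, by ring⟩, ?_⟩
      rw [show k + 1 + 2 = (k + 2) + 1 by ring, pow_succ, ← h2]; ring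

open Classical in
/-- Neighbours of `x` inside `U` along edges of sign `s`. -/
noncomputable def nbr {W : Type} (T : SignedGraph W) (U : Finset W) (s : Bool) (x : W) :
    Finset W :=
  U.filter fun y => T.G.Adj x y ∧ T.sign x y = s

open Classical in
lemma card_bound {W : Type} (T : SignedGraph W) (U : Finset W) (hU : U.Nonempty) (k : ℕ)
    (h : ∀ x ∈ U, ∀ s, bb k ≤ (nbr T U s x).card) : bb (k + 1) ≤ U.card := by
  have hle : ∀ x ∈ U, (nbr T U true x).card + (nbr T U false x).card + 1 ≤ U.card := by
    intro x hx
    have hd : Disjoint (nbr T U true x) (nbr T U false x) := by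
      rw [Finset.disjoint_left]
      intro y hy hy'
      simp only [nbr, Finset.mem_filter] at hy hy'
      have := hy.2.2.symm.trans hy'.2.2
      simp at this
    rw [← Finset.card_union_of_disjoint hd]
    apply Finset.card_lt_card
    refine ⟨?_, ?_⟩
    · intro y hy
      simp only [nbr, Finset.mem_union, Finset.mem_filter] at hy
      tauto
    · intro hs
      have := hs hx
      simp [nbr] at this
  obtain ⟨x0, hx0⟩ := hU
  have h0 := hle x0 hx0
  have h1 := h x0 hx0 true
  have h2 := h x0 hx0 false
  by_cases he : Even (bb k)
  · simp only [bb, if_pos he]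
    omega
  · simp only [bb, if_neg he]
    by_contra hc
    have hcard : U.card = 2 * bb k + 1 := by omega
    let H : SimpleGraph U :=
      { Adj := fun x y => T.G.Adj x y ∧ T.sign x y = true
        symm := ⟨fun x y hxy => ⟨hxy.1.symm, (T.sign_symm _ _).trans hxy.2⟩⟩
        loopless := ⟨fun x hx => T.G.loopless.irrefl _ hx.1⟩ }
    have hdeg : ∀ x : U, H.degree x = bb k := by
      intro x
      have e : H.degree x = (nbr T U true x).card := by
        rw [← SimpleGraph.card_neighborFinset_eq_degree]
        rw [← Finset.card_map (Function.Embedding.subtype _)]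
        congr 1
        ext y
        simp [nbr, H]
        tauto
      have a := hle x x.2
      have b := h x x.2 true
      have c := h x x.2 false
      omega
    have hev := H.even_card_odd_degree_vertices
    have ho : Odd (bb k) := by simpa using he
    simp only [hdeg, ho] at hev
    simp [hcard] at hev

/-- The sign-preserving lower bound. -/
lemma sp_bound (k : ℕ) : ∀ (W : Type) (T : SignedGraph W) (U : Finset W), U.card < bb k →
    ∃ (V : Type) (_ : Finite V) (S : SignedGraph V), ¬ S.G.HasCompleteMinor (k + 1) ∧
      ¬ ∃ f : V → W, (∀ u, f u ∈ U) ∧ IsSpHom S T f := by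
  classical
  induction k with
  | zero => intro W T U h; simp [bb] at h
  | succ k ih =>
    intro W T U
    induction U using Finset.strongInduction with
    | H U ihU =>
      intro hU
      by_contra hall
      push Not at hall
      have hne : U.Nonempty := by
        obtain ⟨f, hf, _⟩ := hall Unit inferInstance oneSG (one_minor k)
        exact ⟨_, hf ()⟩
      refine absurd (card_bound T U hne k ?_) (not_le.2 hU)
      intro x hx s
      by_contra hlt
      push Not at hlt
      obtain ⟨V1, hV1, S1, hm1, hn1⟩ := ihU (U.erase x) (Finset.erase_ssubset hx)
        (lt_of_le_of_lt (Finset.card_erase_le) hU)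
      obtain ⟨V2, hV2, S2, hm2, hn2⟩ := ih W T (nbr T U s x) hlt
      obtain ⟨f, hfU, hf⟩ := hall (V1 × Option V2) inferInstance (starSG S1 S2 s)
        (star_minor S1 S2 s hm1 hm2)
      have hx' : ∃ v, f (v, none) = x := by
        by_contra hno
        push Not at hno
        exact hn1 ⟨fun v => f (v, none), fun v => Finset.mem_erase.2 ⟨hno v, hfU _⟩,
          fun u v huv => hf (u, none) (v, none) huv⟩
      obtain ⟨v, hv⟩ := hx'
      refine hn2 ⟨fun w => f (v, some w), fun w => ?_,
        fun a b hab => hf (v, some a) (v, some b) ⟨rfl, hab⟩⟩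
      have := hf (v, none) (v, some w) rfl
      rw [hv] at this
      simp only [nbr, Finset.mem_filter]
      exact ⟨hfU _, this.1, this.2⟩

lemma tri_bound (k : ℕ) (W : Type) (T : SignedGraph W) (U : Finset W) : U.card < bb k + 1 →
    ∃ (V : Type) (_ : Finite V) (S : SignedGraph V), ¬ S.G.HasCompleteMinor (k + 2) ∧
      ¬ ∃ f : V → W, (∀ u, f u ∈ U) ∧ IsTri S T f := by
  classical
  induction U using Finset.strongInduction with
  | H U ihU =>
    intro hU
    by_contra hall
    push Not at hall
    have hne : U.Nonempty := by
      obtain ⟨f, hf, _⟩ := hall Unit inferInstance oneSG (one_minor k)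
      exact ⟨_, hf ()⟩
    obtain ⟨x, hx⟩ := hne
    obtain ⟨V1, hV1, S1, hm1, hn1⟩ := ihU (U.erase x) (Finset.erase_ssubset hx)
      (lt_of_le_of_lt (Finset.card_erase_le) hU)
    let T' : SignedGraph W := ⟨T.G, fun y z => (T.sign x y == (T.sign y z == T.sign z x)), by
      intro y z
      rw [T.sign_symm x y, T.sign_symm y z, T.sign_symm z x]
      cases T.sign y x <;> cases T.sign z y <;> cases T.sign x z <;> rfl⟩
    obtain ⟨V2, hV2, S2, hm2, hn2⟩ := sp_bound k W T' (U.filter fun y => T.G.Adj x y) (by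
      have : (U.filter fun y => T.G.Adj x y).card < U.card := by
        apply Finset.card_lt_card
        refine ⟨Finset.filter_subset _ _, fun hs => ?_⟩
        have := hs hx
        simp at this
      omega)
    obtain ⟨f, hfU, hf, hft⟩ := hall (V1 × Option V2) inferInstance (starSG S1 S2 true)
      (star_minor S1 S2 true hm1 hm2)
    have hx' : ∃ v, f (v, none) = x := by
      by_contra hno
      push Not at hno
      exact hn1 ⟨fun v => f (v, none), fun v => Finset.mem_erase.2 ⟨hno v, hfU _⟩,
        fun u v huv => hf (u, none) (v, none) huv,
        fun a b c hab hbc hca => hft (a, none) (b, none) (c, none) hab hbc hca⟩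
    obtain ⟨v, hv⟩ := hx'
    refine hn2 ⟨fun w => f (v, some w), fun w => ?_, fun a b hab =>
      ⟨hf (v, some a) (v, some b) ⟨rfl, hab⟩, ?_⟩⟩
    · have := hf (v, none) (v, some w) rfl
      rw [hv] at this
      exact Finset.mem_filter.2 ⟨hfU _, this⟩
    · have := hft (v, none) (v, some a) (v, some b) rfl ⟨rfl, hab⟩ rfl
      rw [hv] at this
      refine this.trans ?_
      simp [starSG]

instance finiteSG (k : ℕ) : Finite (SignedGraph (Fin k)) := by
  refine Finite.of_injective
    (fun T : SignedGraph (Fin k) => ((fun a b => T.G.Adj a b, T.sign) :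
      (Fin k → Fin k → Prop) × (Fin k → Fin k → Bool))) ?_
  rintro ⟨⟨A, _, _⟩, s, _⟩ ⟨⟨A', _, _⟩, s', _⟩ h
  simp only [Prod.mk.injEq] at h
  obtain ⟨h1, h2⟩ := h
  have h1' : A = A' := h1
  subst h1'
  subst h2
  rfl

lemma union_bound (k : ℕ) (s : Set (Σ j : Fin (bb k + 1), SignedGraph (Fin j))) (hs : s.Finite) :
    ∃ (V : Type) (_ : Finite V) (S : SignedGraph V), ¬ S.G.HasCompleteMinor (k + 2) ∧
      ∀ p ∈ s, ¬ ∃ f : V → Fin p.1, IsTri S p.2 f := by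
  induction s, hs using Set.Finite.induction_on with
  | empty => exact ⟨Unit, inferInstance, oneSG, one_minor k, by simp⟩
  | @insert p s _ _ ih =>
    obtain ⟨V1, hV1, S1, hm1, h1⟩ := ih
    obtain ⟨V2, hV2, S2, hm2, h2⟩ := tri_bound k (Fin p.1) p.2 Finset.univ
      (by simpa using p.1.2)
    refine ⟨V1 ⊕ V2, inferInstance, sumSG S1 S2, sum_minor S1 S2 (by omega) hm1 hm2, ?_⟩
    rintro q hq ⟨f, hf, hft⟩
    rcases hq with rfl | hq
    · refine h2 ⟨f ∘ Sum.inr, fun _ => Finset.mem_univ _, fun u v huv => hf _ _ ?_,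
        fun a b c hab hbc hca => hft (.inr a) (.inr b) (.inr c) ?_ ?_ ?_⟩ <;>
      simpa [sumSG]
    · refine h1 q hq ⟨f ∘ Sum.inl, fun u v huv => hf _ _ ?_,
        fun a b c hab hbc hca => hft (.inl a) (.inl b) (.inl c) ?_ ?_ ?_⟩ <;>
      simpa [sumSG]

lemma final_bound (k : ℕ) : ∃ (m : ℕ) (S : SignedGraph (Fin m)),
    ¬ S.G.HasCompleteMinor (k + 2) ∧ bb k + 1 ≤ chromS S := by
  obtain ⟨V, hV, S, hm, h⟩ := union_bound k Set.univ Set.finite_univ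
  obtain ⟨m, ⟨e⟩⟩ := Finite.exists_equiv_fin V
  let S' : SignedGraph (Fin m) := ⟨S.G.comap e.symm, fun a b => S.sign (e.symm a) (e.symm b),
    fun a b => S.sign_symm _ _⟩
  refine ⟨m, S', ?_, ?_⟩
  · intro hc
    obtain ⟨B, hB⟩ := (hasCompleteMinor_iff _ _).1 hc
    exact hm (minor_pull e e.injective (fun a b hab => by simpa [S'] using hab) B hB
      (fun i x _ => e.surjective x))
  · have hne : {n : ℕ | ∃ T : SignedGraph (Fin n), ∃ f : Fin m → Fin n, IsHom S' T f}.Nonempty := by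
      refine ⟨m, S', id, fun _ _ h => h, fun u w => ?_⟩
      congr 1
      exact SimpleGraph.Walk.map_id w
    refine le_csInf hne ?_
    rintro j ⟨T, f, hf⟩
    by_contra hlt
    push Not at hlt
    obtain ⟨h1, h2⟩ := IsHom.isTri hf
    refine h ⟨⟨j, hlt⟩, T⟩ trivial ⟨f ∘ e, fun u v huv => h1 _ _ (by simpa [S'] using huv),
      fun a b c hab hbc hca => ?_⟩
    have := h2 (e a) (e b) (e c) (by simpa [S'] using hab) (by simpa [S'] using hbc)
      (by simpa [S'] using hca)
    simpa [S'] using this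

open SignedGraph in
/-- For every `n ≥ 2` there is a signed graph with no `K_n` minor and large signed
chromatic number. -/
theorem exists_no_completeMinor_chromS_large (n : ℕ) (hn : 2 ≤ n) :
    ∃ (m : ℕ) (S : SignedGraph (Fin m)), ¬ S.G.HasCompleteMinor n ∧
      (Even n → (2 ^ n - 1) / 3 ≤ chromS S) ∧
      (Odd n → (2 ^ n - 2) / 3 ≤ chromS S) := by
  obtain ⟨k, rfl⟩ := Nat.exists_eq_add_of_le' hn
  obtain ⟨m, S, hm, hc⟩ := final_bound k
  refine ⟨m, S, hm, fun he => ?_, fun ho => ?_⟩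
  · have := ((bb_spec k).1 (by simpa [Nat.even_add] using he)).2
    omega
  · have := ((bb_spec k).2 (by simpa [Nat.odd_add] using ho)).2
    omega
end

section
/- Let u and v be two distinct vertices of a signed graph (G,σ). Then f(u) ≠ f(v) for every signed graph (H,π) and every homomorphism f of (G,σ) to (H,π) if and only if u and v are adjacent in G or there exists a negative 4-cycle of (G,σ) containing both u and v. -/
open SimpleGraph

namespace SignedGraph

theorem walkSign_map_switch {V W : Type} (S : SignedGraph V) (T : SignedGraph W) (f : V → W)
    (s : V → Bool) (hadj : ∀ u v : V, S.G.Adj u v → T.G.Adj (f u) (f v))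
    (hs : ∀ a b, S.G.Adj a b → T.sign (f a) (f b) = ((s a == s b) == S.sign a b))
    {a b : V} (w : S.G.Walk a b) :
    T.walkSign (w.map ⟨f, fun {a b} h => hadj a b h⟩) = ((s a == s b) == S.walkSign w) := by
  induction w with
  | nil => simp [walkSign]
  | @cons a b c h w ih =>
    have h1 : S.walkSign (Walk.cons h w) = (S.sign a b == S.walkSign w) := by
      simp [walkSign]
    have h2 : T.walkSign ((Walk.cons h w).map ⟨f, fun {a b} h => hadj a b h⟩) =
        (T.sign (f a) (f b) == T.walkSign (w.map ⟨f, fun {a b} h => hadj a b h⟩)) := by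
      simp [walkSign]
    rw [h2, h1, ih, hs a b h]
    generalize S.sign a b = x
    generalize S.walkSign w = y
    generalize s a = x1
    generalize s b = x2
    generalize s c = x3
    revert x y x1 x2 x3
    decide

theorem fourCycle_opp {V W : Type} (S : SignedGraph V) (T : SignedGraph W) (f : V → W)
    (hf : IsHom S T f) {p q r s : V} (hpq : S.G.Adj p q) (hqr : S.G.Adj q r)
    (hrs : S.G.Adj r s) (hsp : S.G.Adj s p)
    (hneg : (S.sign p q == (S.sign q r == (S.sign r s == S.sign s p))) = false) :
    f p ≠ f r := by
  intro he
  obtain ⟨hadj, hw⟩ := hf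
  have := hw p (Walk.cons hpq (Walk.cons hqr (Walk.cons hrs (Walk.cons hsp Walk.nil))))
  simp only [walkSign, Walk.map_cons, Walk.map_nil, Walk.darts_cons, Walk.darts_nil,
    List.map_cons, List.map_nil, List.foldr_cons, List.foldr_nil, RelHom.coeFn_mk] at this
  rw [he, T.sign_symm (f s) (f r), T.sign_symm (f q) (f r)] at this
  revert this hneg
  generalize S.sign p q = x1
  generalize S.sign q r = x2
  generalize S.sign r s = x3
  generalize S.sign s p = x4
  generalize T.sign (f r) (f q) = x5
  generalize T.sign (f r) (f s) = x6
  revert x1 x2 x3 x4 x5 x6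
  decide

end SignedGraph

open SignedGraph in
/-- Two distinct vertices of a signed graph have distinct images under every
homomorphism iff they are adjacent or lie on a common negative 4-cycle. -/
theorem forced_distinct_iff_adj_or_negFourCycle {V : Type} [Fintype V]
    (S : SignedGraph V) (u v : V) (huv : u ≠ v) :
    (∀ (W : Type) (T : SignedGraph W) (f : V → W), IsHom S T f → f u ≠ f v) ↔
      (S.G.Adj u v ∨
        ∃ p q r s : V,
          p ≠ q ∧ p ≠ r ∧ p ≠ s ∧ q ≠ r ∧ q ≠ s ∧ r ≠ s ∧
          S.G.Adj p q ∧ S.G.Adj q r ∧ S.G.Adj r s ∧ S.G.Adj s p ∧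
          (S.sign p q == (S.sign q r == (S.sign r s == S.sign s p))) = false ∧
          (u = p ∨ u = q ∨ u = r ∨ u = s) ∧ (v = p ∨ v = q ∨ v = r ∨ v = s)) := by
  classical
  constructor
  · intro H
    by_contra hcon
    obtain ⟨hna, hno⟩ := not_or.mp hcon
    have hc : ∃ c : Bool, ∀ x, S.G.Adj u x → S.G.Adj v x → c = (S.sign u x == S.sign v x) := by
      by_cases hx : ∃ x, S.G.Adj u x ∧ S.G.Adj v x
      · obtain ⟨x, hux, hvx⟩ := hx
        refine ⟨S.sign u x == S.sign v x, fun y huy hvy => ?_⟩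
        by_cases hxy : x = y
        · rw [hxy]
        by_contra hne
        refine hno ⟨u, x, v, y, hux.ne, huv, huy.ne, hvx.ne', hxy, hvy.ne, hux, hvx.symm, hvy,
          huy.symm, ?_, Or.inl rfl, Or.inr (Or.inr (Or.inl rfl))⟩
        rw [S.sign_symm x v, S.sign_symm y u]
        revert hne
        generalize S.sign u x = x1
        generalize S.sign v x = x2
        generalize S.sign u y = x3
        generalize S.sign v y = x4
        revert x1 x2 x3 x4
        decide
      · exact ⟨true, fun x h1 h2 => absurd ⟨x, h1, h2⟩ hx⟩
    obtain ⟨c, hc⟩ := hc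
    let f : V → V := fun x => if x = v then u else x
    let g : V → Bool := fun x => if S.G.Adj u x then S.sign u x else (c == S.sign v x)
    let s : V → Bool := fun x => if x = v then c else true
    let T : SignedGraph V :=
      { G := { Adj := fun a b => a ≠ b ∧ ∃ x y, S.G.Adj x y ∧ f x = a ∧ f y = b
               symm := ⟨fun a b h => ⟨h.1.symm, by
                obtain ⟨_, x, y, h1, h2, h3⟩ := h
                exact ⟨y, x, h1.symm, h3, h2⟩⟩⟩
               loopless := ⟨fun a h => h.1 rfl⟩ }
        sign := fun a b => if a = u then g b else if b = u then g a else S.sign a b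
        sign_symm := by
          intro a b
          by_cases ha : a = u <;> by_cases hb : b = u <;> simp [ha, hb, S.sign_symm a b] }
    have hna' : ¬ S.G.Adj v u := fun h => hna h.symm
    have hadj : ∀ a b : V, S.G.Adj a b → T.G.Adj (f a) (f b) := by
      intro a b h
      refine ⟨?_, a, b, h, rfl, rfl⟩
      have := h.ne
      simp only [f]
      split_ifs <;> grind
    have hg : ∀ b, S.G.Adj v b → g b = (c == S.sign v b) := by
      intro b h
      by_cases hub : S.G.Adj u b
      · have := hc b hub h
        simp only [g, if_pos hub, this]
        generalize S.sign u b = x1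
        generalize S.sign v b = x2
        revert x1 x2
        decide
      · simp only [g, if_neg hub]
    have hg' : ∀ b, S.G.Adj u b → g b = S.sign u b := by
      intro b h
      simp only [g, if_pos h]
    have hs : ∀ a b, S.G.Adj a b → T.sign (f a) (f b) = ((s a == s b) == S.sign a b) := by
      intro a b h
      by_cases hav : a = v
      · subst hav
        have hbu : b ≠ u := fun e => hna' (e ▸ h)
        simp [T, f, s, h.ne', hg b h]
      by_cases hbv : b = v
      · subst hbv
        have hau : a ≠ u := fun e => hna (e ▸ h)
        simp [T, f, s, hav, hau, hg a h.symm, S.sign_symm a b]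
      by_cases hau : a = u
      · subst hau
        simp [T, f, s, hav, hbv, hg' b h]
      by_cases hbu : b = u
      · subst hbu
        simp [T, f, s, hav, hbv, hau, hg' a h.symm, S.sign_symm a b]
      simp [T, f, s, hav, hbv, hau, hbu]
    refine H V T f ⟨hadj, fun a w => ?_⟩ (by simp [f])
    rw [walkSign_map_switch S T f s hadj hs w]
    simp
  · rintro (h | ⟨p, q, r, s, -, -, -, -, -, -, hpq, hqr, hrs, hsp, hneg, hu, hv⟩) W T f hf
    · exact (hf.1 u v h).ne
    · have h1 := fourCycle_opp S T f hf hpq hqr hrs hsp hneg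
      have h2 : f q ≠ f s := by
        refine fourCycle_opp S T f hf hqr hrs hsp hpq ?_
        revert hneg
        generalize S.sign p q = x1
        generalize S.sign q r = x2
        generalize S.sign r s = x3
        generalize S.sign s p = x4
        revert x1 x2 x3 x4
        decide
      have e1 := (hf.1 _ _ hpq).ne
      have e2 := (hf.1 _ _ hqr).ne
      have e3 := (hf.1 _ _ hrs).ne
      have e4 := (hf.1 _ _ hsp).ne
      rcases hu with rfl | rfl | rfl | rfl <;> rcases hv with rfl | rfl | rfl | rfl <;>
        first
        | exact absurd rfl huv
        | assumption
        | (apply Ne.symm; assumption)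
end

section
/- For every prime power q ≡ 1 (mod 4), the signed Paley plus graph (SP_q^+,□^+) is vertex-transitive and edge-transitive (with respect to isomorphisms of signed graphs). -/
open SimpleGraph

namespace SignedGraph

open scoped Classical in
/-- The signed Paley graph on a finite field `F` with `#F ≡ 1 (mod 4)`:
the complete graph on `F`, an edge `uv` being positive iff `u - v` is a nonzero
square in `F`. -/
noncomputable def paley (F : Type) [Field F] [Fintype F]
    (hF : Fintype.card F % 4 = 1) : SignedGraph F where
  G := ⊤
  sign := fun u v => decide (∃ x : F, x ≠ 0 ∧ x * x = u - v)
  sign_symm := by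
    have hsq : IsSquare (-1 : F) := by
      rw [FiniteField.isSquare_neg_one_iff]
      omega
    obtain ⟨i, hi⟩ := hsq
    have hi0 : i ≠ 0 := by
      intro h
      rw [h, mul_zero] at hi
      exact one_ne_zero (neg_eq_zero.mp hi)
    have key : ∀ a b : F, (∃ x : F, x ≠ 0 ∧ x * x = a - b) →
        (∃ x : F, x ≠ 0 ∧ x * x = b - a) := by
      rintro a b ⟨x, hx0, hx⟩
      refine ⟨x * i, mul_ne_zero hx0 hi0, ?_⟩
      have hxi : x * i * (x * i) = x * x * (i * i) := by ring
      rw [hxi, hx, ← hi]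
      ring
    intro u v
    simp only [decide_eq_decide]
    exact ⟨key u v, key v u⟩

end SignedGraph


namespace SignedGraph

/-- The signed Paley plus graph: add a vertex `∞` (here `none`) joined to every
other vertex by a positive edge. -/
noncomputable def paleyPlus (F : Type) [Field F] [Fintype F]
    (hF : Fintype.card F % 4 = 1) : SignedGraph (Option F) where
  G := ⊤
  sign := fun u v =>
    match u, v with
    | none, _ => true
    | _, none => true
    | some a, some b => (paley F hF).sign a b
  sign_symm := by
    rintro (_ | a) (_ | b)
    · rfl
    · rfl
    · rfl
    · exact (paley F hF).sign_symm a b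

end SignedGraph


namespace SignedGraph

/-- A bijection preserving signs up to switching, between complete signed graphs. -/
def GoodPerm {V : Type} (S : SignedGraph V) (e : V ≃ V) : Prop :=
  ∃ s : V → Bool, ∀ u v : V, u ≠ v → S.sign (e u) (e v) = ((s u == s v) == S.sign u v)

theorem GoodPerm.trans {V : Type} {S : SignedGraph V} {e f : V ≃ V}
    (he : GoodPerm S e) (hf : GoodPerm S f) : GoodPerm S (e.trans f) := by
  obtain ⟨s, hs⟩ := he
  obtain ⟨t, ht⟩ := hf
  refine ⟨fun u => s u == t (e u), fun u v huv => ?_⟩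
  have h1 := hs u v huv
  have h2 := ht (e u) (e v) (fun h => huv (e.injective h))
  simp only [Equiv.trans_apply]
  rw [h2, h1]
  cases s u <;> cases s v <;> cases t (e u) <;> cases t (e v) <;> cases S.sign u v <;> rfl

theorem GoodPerm.symm {V : Type} {S : SignedGraph V} {e : V ≃ V}
    (he : GoodPerm S e) : GoodPerm S e.symm := by
  obtain ⟨s, hs⟩ := he
  refine ⟨fun u => s (e.symm u), fun u v huv => ?_⟩
  have h1 := hs (e.symm u) (e.symm v) (fun h => huv (e.symm.injective h))
  simp only [Equiv.apply_symm_apply] at h1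
  rw [h1]
  beta_reduce
  cases s (e.symm u) <;> cases s (e.symm v) <;>
    cases S.sign (e.symm u) (e.symm v) <;> rfl

theorem walkSign_map {V : Type} (S : SignedGraph V) (f : S.G →g S.G) (s : V → Bool)
    (h : ∀ u v : V, u ≠ v → S.sign (f u) (f v) = ((s u == s v) == S.sign u v))
    {u v : V} (w : S.G.Walk u v) :
    S.walkSign (w.map f) = ((s u == s v) == S.walkSign w) := by
  induction w with
  | nil => simp [walkSign]
  | @cons a b c hab p ih =>
    have h1 := h a b hab.ne
    have e1 : S.walkSign ((Walk.cons hab p).map f)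
        = (S.sign (f a) (f b) == S.walkSign (p.map f)) := by
      simp [walkSign]
    have e2 : S.walkSign (Walk.cons hab p) = (S.sign a b == S.walkSign p) := by
      simp [walkSign]
    rw [e1, e2, h1, ih]
    cases s a <;> cases s b <;> cases s c <;> cases S.sign a b <;> cases S.walkSign p <;> rfl

theorem GoodPerm.isHom {V : Type} {S : SignedGraph V} (hS : S.G = ⊤) {e : V ≃ V}
    (he : GoodPerm S e) : IsHom S S e := by
  obtain ⟨s, hs⟩ := he
  refine ⟨fun u v h => ?_, fun u w => ?_⟩
  · rw [hS, SimpleGraph.top_adj]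
    exact fun h' => h.ne (e.injective h')
  · rw [walkSign_map S _ s hs w]
    simp

theorem GoodPerm.isIso {V : Type} {S : SignedGraph V} (hS : S.G = ⊤) {e : V ≃ V}
    (he : GoodPerm S e) : IsIso S S e :=
  ⟨e.bijective, he.isHom hS, e.symm, e.left_inv, e.right_inv, he.symm.isHom hS⟩

open scoped Classical in
/-- The quadratic residue indicator. -/
noncomputable def resid (F : Type) [Field F] (c : F) : Bool :=
  decide (∃ x : F, x ≠ 0 ∧ x * x = c)

theorem resid_iff {F : Type} [Field F] {c : F} (hc : c ≠ 0) :
    resid F c = true ↔ IsSquare c := by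
  simp only [resid, decide_eq_true_eq]
  constructor
  · rintro ⟨x, -, h⟩
    exact ⟨x, h.symm⟩
  · rintro ⟨x, h⟩
    exact ⟨x, by rintro rfl; simp at h; exact hc h, h.symm⟩

theorem resid_mul {F : Type} [Field F] [Fintype F] {a b : F} (ha : a ≠ 0) (hb : b ≠ 0) :
    resid F (a * b) = (resid F a == resid F b) := by
  classical
  have key : ∀ c : F, c ≠ 0 → (resid F c = true ↔ quadraticChar F c = 1) := fun c hc =>
    (resid_iff hc).trans (quadraticChar_one_iff_isSquare hc).symm
  have k1 := key a ha
  have k2 := key b hb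
  have k3 := key (a * b) (mul_ne_zero ha hb)
  rw [map_mul] at k3
  rcases quadraticChar_dichotomy ha with h1 | h1 <;>
    rcases quadraticChar_dichotomy hb with h2 | h2 <;>
    rw [h1] at k1 k3 <;> rw [h2] at k2 k3 <;> norm_num at k1 k2 k3 <;> rw [k1, k2, k3] <;> rfl

theorem resid_inv {F : Type} [Field F] {a : F} (ha : a ≠ 0) :
    resid F a⁻¹ = resid F a := by
  rw [Bool.eq_iff_iff, resid_iff ha, resid_iff (inv_ne_zero ha), isSquare_inv]

open scoped Classical in
/-- The inversion of the projective line. -/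
noncomputable def invFn (F : Type) [Field F] : Option F → Option F
  | none => some 0
  | some a => if a = 0 then none else some a⁻¹

theorem invFn_involutive (F : Type) [Field F] : Function.Involutive (invFn F) := by
  rintro (_ | a)
  · simp [invFn]
  · by_cases h : a = 0 <;> simp [invFn, h]

open scoped Classical in
/-- Switching function for the inversion. -/
noncomputable def invSw (F : Type) [Field F] : Option F → Bool
  | none => true
  | some a => if a = 0 then true else resid F a

section
variable (F : Type) [Field F] [Fintype F] (hF : Fintype.card F % 4 = 1)

theorem sign_some (a b : F) : (paleyPlus F hF).sign (some a) (some b) = resid F (a - b) := by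
  simp only [paleyPlus, paley, resid, decide_eq_decide]

theorem sign_none_left (b : Option F) : (paleyPlus F hF).sign none b = true := rfl

theorem sign_none_right (b : Option F) : (paleyPlus F hF).sign b none = true := by
  cases b <;> rfl

theorem good_inv : GoodPerm (paleyPlus F hF) (invFn_involutive F).toPerm := by
  have hneg : ∀ c : F, resid F (-c) = resid F c := fun c => by
    have := (paleyPlus F hF).sign_symm (some 0) (some c)
    rw [sign_some, sign_some] at this
    simpa using this
  refine ⟨invSw F, ?_⟩
  have hall : ∀ u v : Option F, u ≠ v → (paleyPlus F hF).sign (invFn F u) (invFn F v) =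
      ((invSw F u == invSw F v) == (paleyPlus F hF).sign u v) := by
    rintro (_ | a) (_ | b) huv
    · exact absurd rfl huv
    · by_cases hb : b = 0
      · simp [invFn, invSw, hb, sign_none_left, sign_none_right]
      · simp [invFn, invSw, hb, sign_none_left, sign_some, hneg, resid_inv hb]
    · by_cases ha : a = 0
      · simp [invFn, invSw, ha, sign_none_left, sign_none_right]
      · simp [invFn, invSw, ha, sign_none_right, sign_some, resid_inv ha]
    · have hab : a ≠ b := fun h => huv (by rw [h])
      by_cases ha : a = 0
      · by_cases hb : b = 0
        · exact absurd (ha.trans hb.symm) hab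
        · simp [invFn, invSw, ha, hb, sign_none_left, sign_some, hneg]
      · by_cases hb : b = 0
        · simp [invFn, invSw, ha, hb, sign_none_right, sign_some]
        · have e : a⁻¹ - b⁻¹ = -((a * b)⁻¹ * (a - b)) := by
            field_simp
            ring
          simp only [invFn, invSw, ha, hb, if_false, sign_some]
          rw [e, hneg, resid_mul (inv_ne_zero (mul_ne_zero ha hb)) (sub_ne_zero.mpr hab),
            resid_inv (mul_ne_zero ha hb), resid_mul ha hb]
  exact hall

theorem good_add (t : F) : GoodPerm (paleyPlus F hF) (Equiv.optionCongr (Equiv.addRight t)) := by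
  refine ⟨fun _ => true, ?_⟩
  rintro (_ | a) (_ | b) huv
  · exact absurd rfl huv
  · simp [sign_none_left]
  · simp [sign_none_right]
  · simp [sign_some]

theorem exists_good (u v : Option F) (huv : u ≠ v) :
    ∃ e : Option F ≃ Option F, GoodPerm (paleyPlus F hF) e ∧ e u = none ∧ e v = some 0 := by
  have h1 : ∃ e : Option F ≃ Option F, GoodPerm (paleyPlus F hF) e ∧ e u = none := by
    rcases u with _ | a
    · exact ⟨_, good_add F hF 0, rfl⟩
    · refine ⟨_, (good_add F hF (-a)).trans (good_inv F hF), ?_⟩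
      simp [invFn]
  obtain ⟨e, he, heu⟩ := h1
  rcases hv : e v with _ | b
  · exact absurd (e.injective (heu.trans hv.symm)) huv
  · refine ⟨_, he.trans (good_add F hF (-b)), ?_, ?_⟩
    · simp [heu]
    · simp [hv]

theorem exists_good_two (u v u' v' : Option F) (h : u ≠ v) (h' : u' ≠ v') :
    ∃ f : Option F → Option F,
      IsIso (paleyPlus F hF) (paleyPlus F hF) f ∧ f u = u' ∧ f v = v' := by
  obtain ⟨e, he, h1, h2⟩ := exists_good F hF u v h
  obtain ⟨e', he', h1', h2'⟩ := exists_good F hF u' v' h'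
  refine ⟨_, (he.trans he'.symm).isIso rfl, ?_, ?_⟩
  · simp [h1, Equiv.symm_apply_eq, h1']
  · simp [h2, Equiv.symm_apply_eq, h2']

end

end SignedGraph

open SignedGraph in
/-- The signed Paley plus graph is vertex-transitive and edge-transitive with
respect to isomorphisms of signed graphs. -/
theorem paleyPlus_vertexTransitive_edgeTransitive
    (F : Type) [Field F] [Fintype F] (hF : Fintype.card F % 4 = 1) :
    (∀ u v : Option F, ∃ f : Option F → Option F,
        IsIso (paleyPlus F hF) (paleyPlus F hF) f ∧ f u = v) ∧
    (∀ u v u' v' : Option F,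
        (paleyPlus F hF).G.Adj u v → (paleyPlus F hF).G.Adj u' v' →
        ∃ f : Option F → Option F,
          IsIso (paleyPlus F hF) (paleyPlus F hF) f ∧ f u = u' ∧ f v = v') := by
  refine ⟨fun u v => ?_, fun u v u' v' h h' => exists_good_two F hF u v u' v' h.ne h'.ne⟩
  obtain ⟨x, hx⟩ := exists_ne u
  obtain ⟨y, hy⟩ := exists_ne v
  obtain ⟨f, hf, h1, -⟩ := exists_good_two F hF u x v y hx.symm hy.symm
  exact ⟨f, hf, h1⟩
end

section
/- For every prime power q ≡ 1 (mod 4), the signed Paley graph (SP_q,□) has property P_{1,(q−1)/2} and property P_{2,(q−5)/4}. -/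
open SimpleGraph

namespace SignedGraph

/-- The `α`-neighborhood `N^α(v)` of a vertex in a signed graph
(`α = true` for positive, `α = false` for negative). -/
def signedNbhd {V : Type} (S : SignedGraph V) (v : V) (α : Bool) : Set V :=
  {u | S.G.Adj v u ∧ S.sign v u = α}

/-- Property `P_{k,ℓ}`: for every `k`-tuple of distinct vertices and every sign
vector, the common signed neighborhood has at least `ℓ` vertices. -/
def HasPropP {V : Type} (S : SignedGraph V) (k ℓ : ℕ) : Prop :=
  ∀ v : Fin k → V, Function.Injective v → ∀ α : Fin k → Bool,
    ℓ ≤ (⋂ i, signedNbhd S (v i) (α i)).ncard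

/-- Property `P̂_{k,ℓ}`: the switched version of `P_{k,ℓ}`, using
`N̂^α(v⃗) = N^α(v⃗) ∪ N^{-α}(v⃗)`. -/
def HasPropPhat {V : Type} (S : SignedGraph V) (k ℓ : ℕ) : Prop :=
  ∀ v : Fin k → V, Function.Injective v → ∀ α : Fin k → Bool,
    ℓ ≤ ((⋂ i, signedNbhd S (v i) (α i)) ∪
         (⋂ i, signedNbhd S (v i) (!(α i)))).ncard

end SignedGraph


open scoped Classical in
/-- The integer `±1` attached to a sign. -/
noncomputable def sgnInt (b : Bool) : ℤ := if b then 1 else -1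

lemma sgnInt_cases (b : Bool) : sgnInt b = 1 ∨ sgnInt b = -1 := by
  cases b <;> simp [sgnInt]

open scoped Classical in
/-- Integer indicator of the signed neighborhood. -/
noncomputable def nbInd (F : Type) [Field F] [Fintype F]
    (hF : Fintype.card F % 4 = 1) (v : F) (b : Bool) (u : F) : ℤ :=
  if u ∈ SignedGraph.signedNbhd (SignedGraph.paley F hF) v b then 1 else 0

open scoped Classical in
lemma two_nbInd (F : Type) [Field F] [Fintype F]
    (hF : Fintype.card F % 4 = 1) (v : F) (b : Bool) (u : F) :
    2 * nbInd F hF v b u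
      = 1 + sgnInt b * quadraticChar F (v - u) - (if u = v then 1 else 0) := by
  by_cases huv : u = v
  · subst huv
    simp [nbInd, SignedGraph.signedNbhd, SignedGraph.paley]
  · have hne : v - u ≠ 0 := sub_ne_zero.mpr (Ne.symm huv)
    have hsq : (∃ x : F, x ≠ 0 ∧ x * x = v - u) ↔ quadraticChar F (v - u) = 1 := by
      rw [quadraticChar_one_iff_isSquare hne]
      constructor
      · rintro ⟨x, -, hx⟩
        exact ⟨x, hx.symm⟩
      · rintro ⟨x, hx⟩
        refine ⟨x, ?_, hx.symm⟩
        rintro rfl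
        exact hne (by simpa using hx)
    have hmem : u ∈ SignedGraph.signedNbhd (SignedGraph.paley F hF) v b ↔
        decide (quadraticChar F (v - u) = 1) = b := by
      simp only [SignedGraph.signedNbhd, SignedGraph.paley, Set.mem_ofPred_eq,
        SimpleGraph.top_adj, hsq]
      exact ⟨fun h => h.2, fun h => ⟨Ne.symm huv, h⟩⟩
    unfold nbInd
    simp only [hmem, if_neg huv]
    rcases quadraticChar_dichotomy hne with h | h <;> rw [h] <;> cases b <;> simp [sgnInt]

lemma ringChar_ne_two (F : Type) [Field F] [Fintype F]
    (hF : Fintype.card F % 4 = 1) : ringChar F ≠ 2 := by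
  intro h
  have := FiniteField.even_card_iff_char_two.mp h
  omega

open scoped Classical in
lemma sum_char_sub (F : Type) [Field F] [Fintype F]
    (hF : Fintype.card F % 4 = 1) (v : F) : ∑ u : F, quadraticChar F (v - u) = 0 := by
  rw [← quadraticChar_sum_zero (ringChar_ne_two F hF)]
  exact (Equiv.subLeft v).sum_comp (fun x => quadraticChar F x)

open scoped Classical in
lemma sum_char_mul (F : Type) [Field F] [Fintype F]
    (hF : Fintype.card F % 4 = 1) (a b : F) (hab : a ≠ b) :
    ∑ u : F, quadraticChar F (a - u) * quadraticChar F (b - u) = -1 := by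
  have hd : a - b ≠ 0 := sub_ne_zero.mpr hab
  have hJ := jacobiSum_nontrivial_inv (quadraticChar_ne_one (ringChar_ne_two F hF))
  rw [(quadraticChar_isQuadratic F).inv, jacobiSum] at hJ
  have e := ((Equiv.mulLeft₀ (a - b) hd).trans (Equiv.subLeft a)).sum_comp
    (fun u => quadraticChar F (a - u) * quadraticChar F (b - u))
  rw [← e]
  have key : ∀ x : F, quadraticChar F (a - (a - (a - b) * x)) *
      quadraticChar F (b - (a - (a - b) * x)) =
      quadraticChar F (-1) * (quadraticChar F x * quadraticChar F (1 - x)) := by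
    intro x
    have h1 : a - (a - (a - b) * x) = (a - b) * x := by ring
    have h2 : b - (a - (a - b) * x) = (-1) * ((a - b) * (1 - x)) := by ring
    have h3 := quadraticChar_sq_one hd
    rw [h1, h2]
    simp only [map_mul]
    linear_combination (quadraticChar F (-1) * quadraticChar F x * quadraticChar F (1 - x)) * h3
  have h4 := quadraticChar_sq_one (F := F) (a := -1) (by simp)
  refine (Finset.sum_congr rfl (fun x _ => key x)).trans ?_
  rw [← Finset.mul_sum, hJ]
  linear_combination -h4

open scoped Classical in
lemma ncard_one (F : Type) [Field F] [Fintype F]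
    (hF : Fintype.card F % 4 = 1) (v : F) (b : Bool) :
    2 * ((SignedGraph.signedNbhd (SignedGraph.paley F hF) v b).ncard : ℤ)
      = Fintype.card F - 1 := by
  have h : ((SignedGraph.signedNbhd (SignedGraph.paley F hF) v b).ncard : ℤ)
      = ∑ u : F, nbInd F hF v b u := by
    rw [Set.ncard_eq_toFinset_card']
    simp [nbInd, Finset.sum_ite, Set.toFinset]
    try rfl
  rw [h, Finset.mul_sum]
  simp only [two_nbInd, Finset.sum_sub_distrib, Finset.sum_add_distrib, ← Finset.mul_sum,
    sum_char_sub F hF]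
  simp

open scoped Classical in
lemma ncard_two (F : Type) [Field F] [Fintype F]
    (hF : Fintype.card F % 4 = 1) (v w : F) (hvw : v ≠ w) (b c : Bool) :
    4 * ((SignedGraph.signedNbhd (SignedGraph.paley F hF) v b ∩
        SignedGraph.signedNbhd (SignedGraph.paley F hF) w c).ncard : ℤ)
      = Fintype.card F - 2 - sgnInt b * sgnInt c - sgnInt c * quadraticChar F (w - v)
        - sgnInt b * quadraticChar F (v - w) := by
  have h : ((SignedGraph.signedNbhd (SignedGraph.paley F hF) v b ∩
        SignedGraph.signedNbhd (SignedGraph.paley F hF) w c).ncard : ℤ)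
      = ∑ u : F, nbInd F hF v b u * nbInd F hF w c u := by
    rw [Set.ncard_eq_toFinset_card', Finset.card_eq_sum_ones, Nat.cast_sum,
      ← Finset.sum_subset (Finset.subset_univ (Set.toFinset
      (SignedGraph.signedNbhd (SignedGraph.paley F hF) v b ∩
        SignedGraph.signedNbhd (SignedGraph.paley F hF) w c)))]
    · refine Finset.sum_congr rfl fun u hu => ?_
      rw [Set.mem_toFinset] at hu
      simp [nbInd, hu.1, hu.2]
    · intro u _ hu
      rw [Set.mem_toFinset, Set.mem_inter_iff] at hu
      simp only [nbInd]
      split_ifs <;> simp_all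
  rw [h, Finset.mul_sum]
  have hpt : ∀ u : F, 4 * (nbInd F hF v b u * nbInd F hF w c u) =
      1 + sgnInt b * quadraticChar F (v - u) + sgnInt c * quadraticChar F (w - u)
      + (sgnInt b * sgnInt c) * (quadraticChar F (v - u) * quadraticChar F (w - u))
      - (if u = v then 1 + sgnInt c * quadraticChar F (w - v) else 0)
      - (if u = w then 1 + sgnInt b * quadraticChar F (v - w) else 0) := by
    intro u
    have e : 4 * (nbInd F hF v b u * nbInd F hF w c u) =
      (2 * nbInd F hF v b u) * (2 * nbInd F hF w c u) := by ring
    rw [e, two_nbInd, two_nbInd]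
    by_cases h1 : u = v
    · subst h1
      simp [hvw]
    · by_cases h2 : u = w
      · subst h2
        simp [h1]
      · simp only [if_neg h1, if_neg h2]
        ring
  simp only [hpt, Finset.sum_sub_distrib, Finset.sum_add_distrib, ← Finset.mul_sum,
    sum_char_sub F hF, sum_char_mul F hF v w hvw]
  simp
  ring

open SignedGraph in
/-- The signed Paley graph has properties `P_{1,(q-1)/2}` and `P_{2,(q-5)/4}`. -/
theorem paley_hasPropP (F : Type) [Field F] [Fintype F]
    (hF : Fintype.card F % 4 = 1) :
    HasPropP (paley F hF) 1 ((Fintype.card F - 1) / 2) ∧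
    HasPropP (paley F hF) 2 ((Fintype.card F - 5) / 4) := by
  classical
  constructor
  · intro v _ α
    have h := ncard_one F hF (v 0) (α 0)
    have hi : (⋂ i, signedNbhd (paley F hF) (v i) (α i)) =
        signedNbhd (paley F hF) (v 0) (α 0) := by
      ext u
      simp [Fin.forall_fin_one]
    rw [hi]
    omega
  · intro v hv α
    have hne : v 0 ≠ v 1 := fun h => by simpa using hv h
    have h := ncard_two F hF (v 0) (v 1) hne (α 0) (α 1)
    have hi : (⋂ i, signedNbhd (paley F hF) (v i) (α i)) =
        signedNbhd (paley F hF) (v 0) (α 0) ∩ signedNbhd (paley F hF) (v 1) (α 1) := by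
      ext u
      simp [Fin.forall_fin_two]
    have hsym : quadraticChar F (v 1 - v 0) = quadraticChar F (v 0 - v 1) := by
      have h1 : quadraticChar F (-1) = 1 := by
        rw [quadraticChar_one_iff_isSquare (by simp), FiniteField.isSquare_neg_one_iff]
        omega
      rw [show v 1 - v 0 = (-1) * (v 0 - v 1) by ring, map_mul, h1, one_mul]
    rw [hi]
    rw [hsym] at h
    rcases sgnInt_cases (α 0) with h0 | h0 <;> rcases sgnInt_cases (α 1) with h1 | h1 <;>
      rcases quadraticChar_dichotomy (sub_ne_zero.mpr hne) with h2 | h2 <;>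
      rw [h0, h1, h2] at h <;> omega
end
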